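/- arXiv:2111.12211 — 10 statements merged into one kernel-verified Lean document; each statement's English description precedes it below -/
import Mathlib

section
/- Let A be an n×n dual quaternion matrix, λ a dual quaternion, and x ∈ 𝔻ℚ^n an appreciable vector with A x = x λ. Then λ = (x* x)^{-1} (x* A x), where x* x is a positive appreciable dual number (hence invertible and commuting with dual quaternions). -/
open TrivSqZeroExt Matrix

/-- The quaternions. -/
abbrev HQ := Quaternion ℝ

/-- The dual quaternions: `q = q_st + q_I ε` with `ε² = 0`, `ε` commuting with quaternions. -/
abbrev DQ := DualNumber HQ

/-- Conjugation of a dual quaternion: `q* = q_st* + q_I* ε`. -/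
noncomputable instance : Star DQ :=
  ⟨fun q => inl (star (fst q)) + inr (star (snd q))⟩

/-- A dual quaternion is appreciable if its standard part is nonzero. -/
def DQ.Appreciable (q : DQ) : Prop := fst q ≠ 0

/-- A dual quaternion is a dual number if both parts are real. -/
def DQ.IsDualNum (q : DQ) : Prop := ∃ a b : ℝ, q = inl (a : HQ) + inr (b : HQ)

/-- The total order on dual numbers: `p ≤ q` iff `p_st < q_st`, or `p_st = q_st` and `p_I ≤ q_I`. -/
def DQ.le (p q : DQ) : Prop :=
  (fst p).re < (fst q).re ∨ ((fst p).re = (fst q).re ∧ (snd p).re ≤ (snd q).re)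

/-- The strict total order on dual numbers. -/
def DQ.lt (p q : DQ) : Prop :=
  (fst p).re < (fst q).re ∨ ((fst p).re = (fst q).re ∧ (snd p).re < (snd q).re)

theorem DQ.fst_star_mul_self (q : DQ) :
    fst (star q * q) = ((Quaternion.normSq (fst q) : ℝ) : HQ) := by
  have h : fst (star q) = star (fst q) := by simp [star]
  rw [fst_mul, h, Quaternion.star_mul_self]

theorem DQ.snd_star_mul_self (q : DQ) :
    snd (star q * q) = ((2 * (star (fst q) * snd q).re : ℝ) : HQ) := by
  have h₁ : fst (star q) = star (fst q) := by simp [star]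
  have h₂ : snd (star q) = star (snd q) := by simp [star]
  rw [snd_mul, h₁, h₂, smul_eq_mul, op_smul_eq_mul,
    ← Quaternion.self_add_star', star_mul, star_star]

theorem DQ.fst_sum_star_mul_self {ι : Type*} (s : Finset ι) (x : ι → DQ) :
    fst (∑ i ∈ s, star (x i) * x i) =
      ((∑ i ∈ s, Quaternion.normSq (fst (x i)) : ℝ) : HQ) := by
  rw [fst_sum, Finset.sum_congr rfl fun i _ => DQ.fst_star_mul_self (x i)]
  exact (map_sum (algebraMap ℝ HQ) _ _).symm

theorem DQ.snd_sum_star_mul_self {ι : Type*} (s : Finset ι) (x : ι → DQ) :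
    snd (∑ i ∈ s, star (x i) * x i) =
      ((∑ i ∈ s, 2 * (star (fst (x i)) * snd (x i)).re : ℝ) : HQ) := by
  rw [snd_sum, Finset.sum_congr rfl fun i _ => DQ.snd_star_mul_self (x i)]
  exact (map_sum (algebraMap ℝ HQ) _ _).symm

/-- If `λ` is a right eigenvalue of a dual quaternion matrix `A` with appreciable right
eigenvector `x`, then `λ = (x* x)⁻¹ (x* A x)`, where `x* x` is a positive appreciable
dual number (hence invertible). -/
theorem right_eigenvalue_formula_dual_quaternion {n : ℕ}
    (A : Matrix (Fin n) (Fin n) DQ) (lam : DQ) (x : Fin n → DQ)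
    (hx : ∃ i, fst (x i) ≠ 0) (heig : A.mulVec x = fun i => x i * lam) :
    (DQ.IsDualNum (∑ i, star (x i) * x i) ∧ DQ.lt 0 (∑ i, star (x i) * x i) ∧
      fst (∑ i, star (x i) * x i) ≠ 0 ∧ IsUnit (∑ i, star (x i) * x i)) ∧
    lam = Ring.inverse (∑ i, star (x i) * x i) * ∑ i, star (x i) * A.mulVec x i := by
  have hpos : 0 < ∑ i, Quaternion.normSq (fst (x i)) := by
    obtain ⟨i, hi⟩ := hx
    exact Finset.sum_pos' (fun _ _ => Quaternion.normSq_nonneg)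
      ⟨i, Finset.mem_univ i,
        lt_of_le_of_ne Quaternion.normSq_nonneg (Quaternion.normSq_ne_zero.2 hi).symm⟩
  have hfst := DQ.fst_sum_star_mul_self Finset.univ x
  have hsnd := DQ.snd_sum_star_mul_self Finset.univ x
  have hne : fst (∑ i, star (x i) * x i) ≠ 0 := by
    rw [hfst]
    intro h
    exact hpos.ne' (Quaternion.coe_injective h)
  have hunit : IsUnit (∑ i, star (x i) * x i) :=
    isUnit_iff_isUnit_fst.2 hne.isUnit
  have hdual : DQ.IsDualNum (∑ i, star (x i) * x i) :=
    ⟨∑ i, Quaternion.normSq (fst (x i)), ∑ i, 2 * (star (fst (x i)) * snd (x i)).re, by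
      rw [← hfst, ← hsnd, inl_fst_add_inr_snd_eq]⟩
  refine ⟨⟨hdual, Or.inl ?_, hne, hunit⟩, ?_⟩
  · rw [hfst]
    exact hpos
  · have hsum : ∑ i, star (x i) * A.mulVec x i = (∑ i, star (x i) * x i) * lam := by
      simp only [heig, Finset.sum_mul, mul_assoc]
    rw [hsum, Ring.inverse_mul_cancel_left _ _ hunit]
end

section
/- Let A = A_st + A_I ε be an n×n dual quaternion matrix and suppose λ = λ_st + λ_I ε is a right eigenvalue of A with right eigenvector x = x_st + x_I ε (so A x = x λ and x is appreciable). Then x_st ≠ 0, A_st x_st = x_st λ_st (so λ_st is a right eigenvalue of the quaternion matrix A_st with right eigenvector x_st), and λ_st = (x_st* x_st)^{-1} (x_st* A_st x_st). -/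
open TrivSqZeroExt Matrix

/-- The self-pairing `v* v` of a nonzero quaternion vector is nonzero. -/
theorem sum_star_mul_self_ne_zero {ι : Type*} [Fintype ι] {v : ι → HQ} (hv : ∃ i, v i ≠ 0) :
    ∑ i, star (v i) * v i ≠ 0 := by
  obtain ⟨i, hi⟩ := hv
  have hsum : ∑ j, star (v j) * v j = ((∑ j, Quaternion.normSq (v j) : ℝ) : HQ) := by
    simp only [Quaternion.star_mul_self]
    exact (map_sum (algebraMap ℝ HQ) _ _).symm
  rw [hsum]
  have hpos : 0 < ∑ j, Quaternion.normSq (v j) :=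
    Finset.sum_pos' (fun j _ => Quaternion.normSq_nonneg)
      ⟨i, Finset.mem_univ i,
        lt_of_le_of_ne Quaternion.normSq_nonneg (Ne.symm (Quaternion.normSq_ne_zero.mpr hi))⟩
  exact fun h => hpos.ne' (Quaternion.coe_injective h)

/-- If `λ = λ_st + λ_I ε` is a right eigenvalue of `A = A_st + A_I ε` with right eigenvector
`x = x_st + x_I ε` (so `A x = x λ` and `x` is appreciable), then `x_st ≠ 0`,
`A_st x_st = x_st λ_st`, and `λ_st = (x_st* x_st)⁻¹ (x_st* A_st x_st)`. -/
theorem standard_part_is_right_eigenvalue {n : ℕ}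
    (A : Matrix (Fin n) (Fin n) DQ) (lam : DQ) (x : Fin n → DQ)
    (hx : ∃ i, fst (x i) ≠ 0) (heig : A.mulVec x = fun i => x i * lam) :
    (fun i => fst (x i)) ≠ (0 : Fin n → HQ) ∧
    (Matrix.of fun i j => fst (A i j)).mulVec (fun i => fst (x i)) =
      (fun i => fst (x i) * fst lam) ∧
    fst lam = (∑ i, star (fst (x i)) * fst (x i))⁻¹ *
      ∑ i, star (fst (x i)) *
        (Matrix.of fun i j => fst (A i j)).mulVec (fun i => fst (x i)) i := by
  have hst : (Matrix.of fun i j => fst (A i j)).mulVec (fun i => fst (x i)) =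
      (fun i => fst (x i) * fst lam) := by
    funext i
    have h := congrArg fst (congrFun heig i)
    simpa only [Matrix.mulVec, dotProduct, fst_sum, fst_mul, Matrix.of_apply] using h
  refine ⟨?_, hst, ?_⟩
  · obtain ⟨i, hi⟩ := hx
    exact fun h => hi (congrFun h i)
  · rw [hst]
    simp only [← mul_assoc, ← Finset.sum_mul]
    rw [inv_mul_cancel₀ (sum_star_mul_self_ne_zero hx), one_mul]
end

section
/- Let A = A_st + A_I ε be an n×n dual quaternion Hermitian matrix (A* = A) and let λ = λ_st + λ_I ε be a right eigenvalue of A with right eigenvector x = x_st + x_I ε. Then λ is a dual number (λ_st and λ_I are real), so λ is an eigenvalue of A, and moreover λ_I = (x_st* x_st)^{-1} (x_st* A_I x_st). -/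
open TrivSqZeroExt Matrix

/-- The value of a Hermitian quadratic form is self-adjoint. -/
theorem Matrix.IsHermitian.isSelfAdjoint_star_dotProduct_mulVec {ι R : Type*} [Fintype ι]
    [Ring R] [StarRing R] {M : Matrix ι ι R} (hM : M.IsHermitian) (u : ι → R) :
    IsSelfAdjoint (star u ⬝ᵥ M *ᵥ u) := by
  rw [isSelfAdjoint_iff, ← star_dotProduct_star, star_star, star_mulVec, hM.eq,
    ← dotProduct_mulVec]

theorem DQ.fst_star (q : DQ) : fst (star q) = star (fst q) := by
  change fst (inl (star (fst q)) + inr (star (snd q))) = _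
  simp

theorem DQ.snd_star (q : DQ) : snd (star q) = star (snd q) := by
  change snd (inl (star (fst q)) + inr (star (snd q))) = _
  simp

theorem Quaternion.star_dotProduct_self {ι : Type*} [Fintype ι] (u : ι → HQ) :
    star u ⬝ᵥ u = ((∑ i, normSq (u i) : ℝ) : HQ) := by
  simp only [dotProduct, Pi.star_apply, Quaternion.star_mul_self]
  exact (map_sum (algebraMap ℝ HQ) _ _).symm

theorem Quaternion.sum_normSq_ne_zero {ι : Type*} [Fintype ι] {u : ι → HQ}
    (hu : ∃ i, u i ≠ 0) : ∑ i, normSq (u i) ≠ 0 := by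
  obtain ⟨i, hi⟩ := hu
  exact (Finset.sum_pos' (fun j _ => normSq_nonneg) ⟨i, Finset.mem_univ i,
    lt_of_le_of_ne normSq_nonneg (Ne.symm (normSq_ne_zero.2 hi))⟩).ne'

/-- If a nonzero real multiple of a quaternion is self-adjoint, the quaternion is real. -/
theorem Quaternion.exists_eq_coe_of_isSelfAdjoint_coe_mul {r : ℝ} (hr : r ≠ 0) {q : HQ}
    (h : IsSelfAdjoint ((r : HQ) * q)) : ∃ a : ℝ, q = a := by
  refine ⟨q.re, star_eq_self.1 (mul_left_cancel₀ (coe_injective.ne hr) ?_)⟩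
  rw [isSelfAdjoint_iff, star_mul, star_coe] at h
  rw [coe_commutes]
  exact h

/-- A right eigenvalue `λ = λ_st + λ_I ε` of a dual quaternion Hermitian matrix
`A = A_st + A_I ε` (with right eigenvector `x = x_st + x_I ε`) is a dual number — hence an
eigenvalue of `A` — and `λ_I = (x_st* x_st)⁻¹ (x_st* A_I x_st)`. -/
theorem hermitian_right_eigenvalue_is_dual_number {n : ℕ}
    (A : Matrix (Fin n) (Fin n) DQ) (hA : A.IsHermitian)
    (lam : DQ) (x : Fin n → DQ)
    (hx : ∃ i, fst (x i) ≠ 0) (heig : A.mulVec x = fun i => x i * lam) :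
    DQ.IsDualNum lam ∧
    snd lam = (∑ i, star (fst (x i)) * fst (x i))⁻¹ *
      ∑ i, star (fst (x i)) *
        (Matrix.of fun i j => snd (A i j)).mulVec (fun i => fst (x i)) i := by
  set S : Matrix (Fin n) (Fin n) HQ := Matrix.of fun i j => fst (A i j)
  set D : Matrix (Fin n) (Fin n) HQ := Matrix.of fun i j => snd (A i j)
  set u : Fin n → HQ := fun i => fst (x i)
  set v : Fin n → HQ := fun i => snd (x i)
  have hS : S.IsHermitian := IsHermitian.ext fun i j =>
    (DQ.fst_star _).symm.trans (congrArg fst (hA.apply i j))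
  have hD : D.IsHermitian := IsHermitian.ext fun i j =>
    (DQ.snd_star _).symm.trans (congrArg snd (hA.apply i j))
  have hfst : S *ᵥ u = fun i => u i * fst lam := by
    ext1 i
    have h := congrArg fst (congrFun heig i)
    simp only [mulVec, dotProduct, fst_sum, fst_mul] at h
    exact h
  have hsnd : S *ᵥ v + D *ᵥ u = fun i => u i * snd lam + v i * fst lam := by
    ext1 i
    have h := congrArg snd (congrFun heig i)
    simp only [mulVec, dotProduct, snd_sum, snd_mul, smul_eq_mul, MulOpposite.smul_eq_mul_unop,
      MulOpposite.unop_op, Finset.sum_add_distrib] at h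
    exact h
  have hmul (w z : Fin n → HQ) (q : HQ) : (w ⬝ᵥ fun i => z i * q) = (w ⬝ᵥ z) * q := by
    simp [dotProduct, Finset.sum_mul, mul_assoc]
  have hs := Quaternion.star_dotProduct_self u
  have hs0 := Quaternion.sum_normSq_ne_zero (u := u) hx
  set s : ℝ := ∑ i, Quaternion.normSq (u i)
  obtain ⟨a, ha⟩ : ∃ a : ℝ, fst lam = a := by
    apply Quaternion.exists_eq_coe_of_isSelfAdjoint_coe_mul hs0
    rw [← hs, ← hmul, ← hfst]
    exact hS.isSelfAdjoint_star_dotProduct_mulVec u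
  have hSv : star u ⬝ᵥ S *ᵥ v = (star u ⬝ᵥ v) * fst lam := by
    have hrow : star u ᵥ* S = fun i => fst lam * star u i := by
      have h := star_mulVec S u
      rw [hS.eq, hfst] at h
      rw [← h]
      ext1 i
      simp [ha]
    rw [dotProduct_mulVec, hrow, ha, ← Quaternion.coe_commutes]
    simp [dotProduct, Finset.mul_sum, mul_assoc]
  have hDu : star u ⬝ᵥ D *ᵥ u = s * snd lam := by
    have h := congrArg (star u ⬝ᵥ ·) hsnd
    change star u ⬝ᵥ (S *ᵥ v + D *ᵥ u) =
      star u ⬝ᵥ ((fun i => u i * snd lam) + fun i => v i * fst lam) at h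
    rw [dotProduct_add, dotProduct_add, hmul, hmul, hSv, hs, add_comm] at h
    exact add_right_cancel h
  obtain ⟨b, hb⟩ : ∃ b : ℝ, snd lam = b := by
    apply Quaternion.exists_eq_coe_of_isSelfAdjoint_coe_mul hs0
    rw [← hDu]
    exact hD.isSelfAdjoint_star_dotProduct_mulVec u
  refine ⟨⟨a, b, by rw [← ha, ← hb, inl_fst_add_inr_snd_eq]⟩, ?_⟩
  change snd lam = (star u ⬝ᵥ u)⁻¹ * (star u ⬝ᵥ D *ᵥ u)
  rw [hDu, hs, inv_mul_cancel_left₀ (Quaternion.coe_injective.ne hs0)]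
end

section
/- Let A = A_st + A_I ε be an n×n dual quaternion Hermitian matrix that is positive semidefinite. Then every eigenvalue of A (every dual number λ with A x = x λ for some appreciable x) is a nonnegative dual number, and the quaternion Hermitian matrix A_st is positive semidefinite (y* A_st y ≥ 0 for all y ∈ ℍ^n). -/
open TrivSqZeroExt Matrix

theorem DQ.fst_sum_star_mul_mulVec {n : ℕ} (A : Matrix (Fin n) (Fin n) DQ) (x : Fin n → DQ) :
    fst (∑ i, star (x i) * A.mulVec x i) =
      star (fun i => fst (x i)) ⬝ᵥ (Matrix.of fun i j => fst (A i j)) *ᵥ fun i => fst (x i) := by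
  simp only [fst_sum, fst_mul, DQ.fst_star, Matrix.mulVec, dotProduct, Matrix.of_apply,
    Pi.star_apply]

theorem DQ.isHermitian_fst {n : ℕ} {A : Matrix (Fin n) (Fin n) DQ} (hA : A.IsHermitian) :
    (Matrix.of fun i j => fst (A i j)).IsHermitian := by
  ext1 i j
  have h := congrArg fst (congrFun (congrFun hA i) j)
  rw [Matrix.conjTranspose_apply, DQ.fst_star] at h
  exact h

theorem Quaternion.star_dotProduct_mulVec_eq_coe_re {n : ℕ} {M : Matrix (Fin n) (Fin n) HQ}
    (hM : M.IsHermitian) (y : Fin n → HQ) :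
    star y ⬝ᵥ M *ᵥ y = ((star y ⬝ᵥ M *ᵥ y).re : HQ) := by
  rw [← Quaternion.star_eq_self]
  conv_lhs => rw [← Matrix.star_dotProduct_star, star_star, Matrix.star_mulVec, hM.eq,
    ← Matrix.dotProduct_mulVec]

/-- The dual part of the quadratic form at an eigenvector involves the standard part of the
eigenvalue only through a real multiple. -/
theorem DQ.sum_star_mul_mul_re {n : ℕ} (x : Fin n → DQ) (a b : ℝ) :
    (fst (∑ i, star (x i) * (x i * (inl (a : HQ) + inr (b : HQ))))).re =
        (∑ i, Quaternion.normSq (fst (x i))) * a ∧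
      ∃ c : ℝ, (snd (∑ i, star (x i) * (x i * (inl (a : HQ) + inr (b : HQ))))).re =
        (∑ i, Quaternion.normSq (fst (x i))) * b + c * a := by
  have re_sum : ∀ f : Fin n → HQ, (∑ i, f i).re = ∑ i, (f i).re := fun f =>
    map_sum (QuaternionAlgebra.reₗ (R := ℝ) (-1) 0 (-1)) f Finset.univ
  refine ⟨?_, ∑ i, (star (fst (x i)) * snd (x i) + star (snd (x i)) * fst (x i)).re, ?_⟩
  · rw [fst_sum, re_sum, Finset.sum_mul]
    refine Finset.sum_congr rfl fun i _ => ?_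
    simp [DQ.fst_star, Quaternion.normSq_def']
    ring
  · rw [snd_sum, re_sum, Finset.sum_mul, Finset.sum_mul, ← Finset.sum_add_distrib]
    refine Finset.sum_congr rfl fun i _ => ?_
    simp [DQ.fst_star, DQ.snd_star, Quaternion.normSq_def']
    ring

/-- Every eigenvalue of a positive semidefinite dual quaternion Hermitian matrix
`A = A_st + A_I ε` is a nonnegative dual number, and `A_st` is positive semidefinite. -/
theorem psd_hermitian_eigenvalues_nonneg {n : ℕ}
    (A : Matrix (Fin n) (Fin n) DQ) (hA : A.IsHermitian)
    (hpsd : ∀ x : Fin n → DQ, DQ.le 0 (∑ i, star (x i) * A.mulVec x i)) :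
    (∀ (lam : DQ) (x : Fin n → DQ), DQ.IsDualNum lam → (∃ i, fst (x i) ≠ 0) →
      A.mulVec x = (fun i => x i * lam) → DQ.le 0 lam) ∧
    (∀ y : Fin n → HQ, ∃ r : ℝ, 0 ≤ r ∧
      ∑ i, star (y i) * (Matrix.of fun i j => fst (A i j)).mulVec y i = (r : HQ)) := by
  refine ⟨?_, fun y => ?_⟩
  · rintro _ x ⟨a, b, rfl⟩ ⟨i, hi⟩ hx
    have h := hpsd x
    rw [hx] at h
    obtain ⟨hfst, c, hsnd⟩ := DQ.sum_star_mul_mul_re x a b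
    have hN : 0 < ∑ i, Quaternion.normSq (fst (x i)) :=
      Finset.sum_pos' (fun _ _ => Quaternion.normSq_nonneg)
        ⟨i, Finset.mem_univ i, Quaternion.normSq_nonneg.lt_of_ne' (Quaternion.normSq_ne_zero.2 hi)⟩
    simp only [DQ.le, hfst, hsnd, fst_zero, snd_zero, Quaternion.re_zero] at h
    simp only [DQ.le, fst_zero, snd_zero, Quaternion.re_zero, fst_add, snd_add, fst_inl, fst_inr,
      snd_inl, snd_inr, add_zero, zero_add, Quaternion.re_coe]
    rcases h with h | ⟨h₀, h₁⟩
    · exact .inl (pos_of_mul_pos_right h hN.le)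
    · have ha : a = 0 := (mul_eq_zero.1 h₀.symm).resolve_left hN.ne'
      rw [ha, mul_zero, add_zero] at h₁
      exact .inr ⟨ha.symm, nonneg_of_mul_nonneg_right h₁ hN⟩
  · have h := hpsd fun i => inl (y i)
    rw [DQ.le, DQ.fst_sum_star_mul_mulVec] at h
    exact ⟨_, h.elim le_of_lt fun h => h.1.le,
      Quaternion.star_dotProduct_mulVec_eq_coe_re (DQ.isHermitian_fst hA) y⟩
end

section
/- Let A = A_st + A_I ε be an n×n dual quaternion Hermitian matrix that is positive definite. Then every eigenvalue of A (every dual number λ with A x = x λ for some appreciable x) is a positive and appreciable dual number, and the quaternion Hermitian matrix A_st is positive definite (y* A_st y > 0 for all nonzero y ∈ ℍ^n). -/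
open TrivSqZeroExt Matrix

theorem DQ.fst_sum {ι : Type*} (s : Finset ι) (f : ι → DQ) :
    fst (∑ i ∈ s, f i) = ∑ i ∈ s, fst (f i) :=
  map_sum (fstHom ℝ HQ HQ) f s

theorem DQ.fst_mulVec {m n : Type*} [Fintype n] (A : Matrix m n DQ) (x : n → DQ) (i : m) :
    fst (A.mulVec x i) =
      (Matrix.of fun i j => fst (A i j)).mulVec (fun j => fst (x j)) i := by
  simp [Matrix.mulVec, dotProduct, DQ.fst_sum]

/-- The quadratic form of a quaternion Hermitian matrix takes real values. -/
theorem Matrix.IsHermitian.quaternion_form_eq_coe_re {n : Type*} [Fintype n]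
    {B : Matrix n n HQ} (hB : B.IsHermitian) (y : n → HQ) :
    ∑ i, star (y i) * B.mulVec y i = ((∑ i, star (y i) * B.mulVec y i).re : HQ) := by
  have h : star (star y ⬝ᵥ B.mulVec y) = star y ⬝ᵥ B.mulVec y := by
    rw [← star_dotProduct_star, star_star, star_mulVec, hB.eq, dotProduct_mulVec]
  exact Quaternion.star_eq_self.mp h

/-- Every eigenvalue of a positive definite dual quaternion Hermitian matrix
`A = A_st + A_I ε` is a positive appreciable dual number, and `A_st` is positive definite. -/
theorem pd_hermitian_eigenvalues_pos {n : ℕ}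
    (A : Matrix (Fin n) (Fin n) DQ) (hA : A.IsHermitian)
    (hpd : ∀ x : Fin n → DQ, (∃ i, fst (x i) ≠ 0) →
      DQ.lt 0 (∑ i, star (x i) * A.mulVec x i) ∧
      fst (∑ i, star (x i) * A.mulVec x i) ≠ 0) :
    (∀ (lam : DQ) (x : Fin n → DQ), DQ.IsDualNum lam → (∃ i, fst (x i) ≠ 0) →
      A.mulVec x = (fun i => x i * lam) → DQ.lt 0 lam ∧ fst lam ≠ 0) ∧
    (∀ y : Fin n → HQ, y ≠ 0 → ∃ r : ℝ, 0 < r ∧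
      ∑ i, star (y i) * (Matrix.of fun i j => fst (A i j)).mulVec y i = (r : HQ)) := by
  have hB : (Matrix.of fun i j => fst (A i j)).IsHermitian := by
    ext1 i j
    have h := congrArg fst (hA.apply i j)
    rwa [DQ.fst_star] at h
  have hst : ∀ x : Fin n → DQ, (∃ i, fst (x i) ≠ 0) → ∃ r : ℝ, 0 < r ∧
      ∑ i, star (fst (x i)) *
        (Matrix.of fun i j => fst (A i j)).mulVec (fun j => fst (x j)) i = (r : HQ) := by
    intro x hx
    obtain ⟨hpos, hne⟩ := hpd x hx
    have hre := hB.quaternion_form_eq_coe_re fun j => fst (x j)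
    have hfst : fst (∑ i, star (x i) * A.mulVec x i) = ∑ i, star (fst (x i)) *
        (Matrix.of fun i j => fst (A i j)).mulVec (fun j => fst (x j)) i := by
      simp only [DQ.fst_sum, fst_mul, DQ.fst_star, DQ.fst_mulVec]
    unfold DQ.lt at hpos
    rw [hfst] at hpos hne
    refine ⟨_, ?_, hre⟩
    rcases hpos with h | ⟨h, -⟩
    · exact h
    · rw [hre, ← h] at hne
      exact absurd Quaternion.coe_zero hne
  refine ⟨?_, ?_⟩
  · rintro lam x ⟨a, b, rfl⟩ hx hev
    obtain ⟨r, hr, hsum⟩ := hst x hx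
    have hval : ((∑ i, Quaternion.normSq (fst (x i))) * a : ℝ) = r := by
      apply Quaternion.coe_injective
      rw [← hsum, Finset.sum_mul]
      simp only [← DQ.fst_mulVec, hev, fst_mul, ← mul_assoc, Quaternion.star_mul_self]
      simp only [fst_add, fst_inl, fst_inr, add_zero, ← Quaternion.coe_mul]
      exact map_sum (algebraMap ℝ HQ) (fun i => Quaternion.normSq (fst (x i)) * a) Finset.univ
    have ha : 0 < a := by
      refine pos_of_mul_pos_right (hval ▸ hr) ?_
      exact Finset.sum_nonneg fun i _ => Quaternion.normSq_nonneg
    refine ⟨Or.inl ?_, ?_⟩ <;> rw [fst_add, fst_inl, fst_inr, add_zero]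
    · exact ha
    · exact fun h => ha.ne' (Quaternion.coe_injective h)
  · intro y hy
    simpa using hst (fun i => inl (y i)) (by simpa using Function.ne_iff.mp hy)
end

section
/- Let A = A_st + A_I ε be an n×n dual quaternion Hermitian matrix. Suppose λ_st is a real number, x_st ∈ ℍ^n is nonzero, A_st x_st = x_st λ_st, and λ_st is a simple right eigenvalue of A_st in the sense that every y ∈ ℍ^n with A_st y = y λ_st satisfies y = x_st q for some quaternion q. Then λ = λ_st + λ_I ε, with λ_I = (x_st* x_st)^{-1}(x_st* A_I x_st), is an eigenvalue of A, i.e., there exists x_I ∈ ℍ^n such that A (x_st + x_I ε) = (x_st + x_I ε)(λ_st + λ_I ε). -/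
open TrivSqZeroExt Matrix

namespace Quaternion

lemma re_mul_comm (a b : Quaternion ℝ) : (a * b).re = (b * a).re := by
  simp only [re_mul]; ring

lemma re_sum {ι : Type*} (s : Finset ι) (f : ι → Quaternion ℝ) :
    (∑ i ∈ s, f i).re = ∑ i ∈ s, (f i).re := by
  induction s using Finset.cons_induction with
  | empty => simp
  | cons a s ha ih => simp [ih]

end Quaternion

section QuaternionVectors

variable {n : ℕ}

lemma inner_eq_re_dotProduct (x y : EuclideanSpace HQ (Fin n)) :
    inner ℝ x y = (star x.ofLp ⬝ᵥ y.ofLp).re := by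
  simp only [PiLp.inner_apply, dotProduct, Quaternion.re_sum, Pi.star_apply]
  refine Finset.sum_congr rfl fun i _ => ?_
  rw [real_inner_comm, Quaternion.inner_def, Quaternion.re_mul_comm]

/-- The real-linear map `x ↦ B x - x r` on quaternion vectors. -/
noncomputable def mulVecSubSMul (B : Matrix (Fin n) (Fin n) HQ) (r : ℝ) :
    EuclideanSpace HQ (Fin n) →ₗ[ℝ] EuclideanSpace HQ (Fin n) where
  toFun x := WithLp.toLp 2 (B *ᵥ x.ofLp) - r • x
  map_add' x y := by
    rw [WithLp.ofLp_add, mulVec_add, WithLp.toLp_add, smul_add]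
    abel
  map_smul' c x := by
    rw [WithLp.ofLp_smul, mulVec_smul, WithLp.toLp_smul, smul_comm r c x, RingHom.id_apply,
      smul_sub]

lemma isSymmetric_mulVecSubSMul {B : Matrix (Fin n) (Fin n) HQ} (hB : B.IsHermitian) (r : ℝ) :
    (mulVecSubSMul B r).IsSymmetric := by
  intro x y
  simp only [mulVecSubSMul, LinearMap.coe_mk, AddHom.coe_mk, inner_sub_left, inner_sub_right,
    real_inner_smul_left, real_inner_smul_right, inner_eq_re_dotProduct, star_mulVec, hB.eq,
    dotProduct_mulVec]

/-- Fredholm alternative: for Hermitian `B`, the equation `B x - x r = b` is solvable once `b` is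
orthogonal to every solution of the homogeneous equation. -/
lemma exists_mulVec_sub_smul_eq {B : Matrix (Fin n) (Fin n) HQ} (hB : B.IsHermitian) (r : ℝ)
    (b : Fin n → HQ)
    (hb : ∀ y : Fin n → HQ, B *ᵥ y = (fun i => y i * (r : HQ)) → (star y ⬝ᵥ b).re = 0) :
    ∃ x : Fin n → HQ, B *ᵥ x - r • x = b := by
  have hmem : WithLp.toLp 2 b ∈ LinearMap.range (mulVecSubSMul B r) := by
    rw [← Submodule.orthogonal_orthogonal (LinearMap.range (mulVecSubSMul B r)),
      (isSymmetric_mulVecSubSMul hB r).orthogonal_range, Submodule.mem_orthogonal]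
    intro y hy
    rw [inner_eq_re_dotProduct]
    apply hb
    have h := congrArg WithLp.ofLp (sub_eq_zero.mp (LinearMap.mem_ker.mp hy))
    ext1 i
    rw [Quaternion.mul_coe_eq_smul]
    exact congrFun h i
  obtain ⟨x, hx⟩ := hmem
  exact ⟨x.ofLp, congrArg WithLp.ofLp hx⟩

lemma star_dotProduct_self_ne_zero {x : Fin n → HQ} (hx : x ≠ 0) : star x ⬝ᵥ x ≠ 0 := by
  intro h
  have h' := inner_eq_re_dotProduct (WithLp.toLp 2 x) (WithLp.toLp 2 x)
  rw [h, Quaternion.re_zero, inner_self_eq_zero] at h'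
  exact hx (congrArg WithLp.ofLp h')

end QuaternionVectors

/-- If `λ_st` is a simple right eigenvalue of `A_st` (every eigenvector associated with `λ_st`
is a right multiple of `x_st`) with right eigenvector `x_st ≠ 0`, where `A = A_st + A_I ε` is
Hermitian, then `λ = λ_st + λ_I ε` with `λ_I = (x_st* x_st)⁻¹ (x_st* A_I x_st)` is an
eigenvalue of `A`: there is `x_I` with `A (x_st + x_I ε) = (x_st + x_I ε) (λ_st + λ_I ε)`. -/
theorem simple_eigenvalue_extends {n : ℕ}
    (A : Matrix (Fin n) (Fin n) DQ) (hA : A.IsHermitian)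
    (lamst : ℝ) (xst : Fin n → HQ) (hxst : xst ≠ 0)
    (heig : (Matrix.of fun i j => fst (A i j)).mulVec xst =
      fun i => xst i * (lamst : HQ))
    (hsimple : ∀ y : Fin n → HQ,
      (Matrix.of fun i j => fst (A i j)).mulVec y = (fun i => y i * (lamst : HQ)) →
      ∃ q : HQ, y = fun i => xst i * q) :
    ∃ xI : Fin n → HQ,
      A.mulVec (fun i => (inl (xst i) + inr (xI i) : DQ)) =
        fun i => ((inl (xst i) + inr (xI i) : DQ)) *
          (inl (lamst : HQ) + inr ((∑ i, star (xst i) * xst i)⁻¹ *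
            ∑ i, star (xst i) * (Matrix.of fun i j => snd (A i j)).mulVec xst i)) := by
  set B : Matrix (Fin n) (Fin n) HQ := Matrix.of fun i j => fst (A i j)
  set C : Matrix (Fin n) (Fin n) HQ := Matrix.of fun i j => snd (A i j)
  have hB : B.IsHermitian := by
    ext1 i j
    have h := congrArg fst (hA.apply i j)
    simpa [star, B] using h
  set μ : HQ := (∑ i, star (xst i) * xst i)⁻¹ * ∑ i, star (xst i) * (C *ᵥ xst) i with hμ
  have hortho : star xst ⬝ᵥ ((fun i => xst i * μ) - C *ᵥ xst) = 0 := by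
    have hne : ∑ i, star (xst i) * xst i ≠ 0 := star_dotProduct_self_ne_zero hxst
    have hsum : star xst ⬝ᵥ (fun i => xst i * μ) = (∑ i, star (xst i) * xst i) * μ := by
      simp only [dotProduct, Pi.star_apply, Finset.sum_mul, mul_assoc]
    rw [dotProduct_sub, hsum, hμ, mul_inv_cancel_left₀ hne]
    exact sub_self _
  obtain ⟨x, hx⟩ := exists_mulVec_sub_smul_eq hB lamst ((fun i => xst i * μ) - C *ᵥ xst) <| by
    intro y hy
    obtain ⟨q, rfl⟩ := hsimple y hy
    have hq : star (fun i => xst i * q) ⬝ᵥ ((fun i => xst i * μ) - C *ᵥ xst) =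
        star q * (star xst ⬝ᵥ ((fun i => xst i * μ) - C *ᵥ xst)) := by
      simp only [dotProduct, Pi.star_apply, star_mul, Finset.mul_sum, mul_assoc]
    rw [hq, hortho, mul_zero, Quaternion.re_zero]
  refine ⟨x, funext fun i => ?_⟩
  have hfst := congrFun heig i
  have hsnd := congrFun hx i
  simp only [Pi.sub_apply, Pi.smul_apply, mulVec, dotProduct, B, C, Matrix.of_apply] at hfst hsnd
  ext1
  · simpa [mulVec, dotProduct, fst_sum] using hfst
  · rw [sub_eq_sub_iff_add_eq_add] at hsnd
    rw [← Quaternion.mul_coe_eq_smul] at hsnd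
    simpa [mulVec, dotProduct, snd_sum, Finset.sum_add_distrib, add_comm] using hsnd
end

section
/- Let A = A_st + A_I ε be an n×n dual quaternion Hermitian matrix. Suppose x_{st,1}, …, x_{st,n} ∈ ℍ^n form an orthonormal basis (x_{st,i}* x_{st,j} = δ_{ij}) with A_st x_{st,i} = λ_{st,i} x_{st,i}, where λ_{st,1}, …, λ_{st,n} are pairwise distinct real numbers. Define λ_{I,i} = x_{st,i}* A_I x_{st,i} and x_{I,i} = Σ_{j≠i} (λ_{st,i} − λ_{st,j})^{-1} x_{st,j} x_{st,j}* (A_I − λ_{I,i} I_n) x_{st,i}. Then for each i, A (x_{st,i} + x_{I,i} ε) = (x_{st,i} + x_{I,i} ε)(λ_{st,i} + λ_{I,i} ε), i.e., λ_{st,i} + λ_{I,i} ε is an eigenvalue of A with eigenvector x_{st,i} + x_{I,i} ε. -/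
open TrivSqZeroExt Matrix

/-- `λ_{I,i} = x_{st,i}* A_I x_{st,i}`. -/
noncomputable def lamI {n : ℕ} (AI : Matrix (Fin n) (Fin n) HQ)
    (xst : Fin n → Fin n → HQ) (i : Fin n) : HQ :=
  ∑ k, star (xst i k) * AI.mulVec (xst i) k

/-- `x_{I,i} = Σ_{j≠i} (λ_{st,i} − λ_{st,j})⁻¹ x_{st,j} x_{st,j}* (A_I − λ_{I,i} I_n) x_{st,i}`. -/
noncomputable def xI {n : ℕ} (AI : Matrix (Fin n) (Fin n) HQ)
    (lamst : Fin n → ℝ) (xst : Fin n → Fin n → HQ) (i k : Fin n) : HQ :=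
  ∑ j ∈ Finset.univ.erase i, (lamst i - lamst j)⁻¹ •
    (xst j k * ∑ l, star (xst j l) *
      (AI.mulVec (xst i) l - lamI AI xst i * xst i l))

/-- For an orthonormal family of `n` quaternion vectors, `∑ j, x_j x_j* = I_n`. -/
theorem sum_mul_star_of_orthonormal {n : ℕ} (x : Fin n → Fin n → HQ)
    (h : ∀ i j, ∑ k, star (x i k) * x j k = if i = j then (1 : HQ) else 0) (k l : Fin n) :
    ∑ j, x j k * star (x j l) = if k = l then (1 : HQ) else 0 := by
  have h1 : (Matrix.of fun i k => star (x i k)) * (Matrix.of fun k j => x j k) =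
      (1 : Matrix (Fin n) (Fin n) HQ) := by
    ext1 i j
    simpa only [Matrix.mul_apply, Matrix.one_apply, Matrix.of_apply] using h i j
  have h2 := mul_eq_one_comm.mp h1
  simpa only [Matrix.mul_apply, Matrix.one_apply, Matrix.of_apply] using
    congrArg (fun M : Matrix (Fin n) (Fin n) HQ => M k l) h2

/-- Expansion of a quaternion vector in an orthonormal basis. -/
theorem sum_mul_inner_of_orthonormal {n : ℕ} (x : Fin n → Fin n → HQ)
    (h : ∀ i j, ∑ k, star (x i k) * x j k = if i = j then (1 : HQ) else 0)
    (v : Fin n → HQ) (k : Fin n) :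
    ∑ j, x j k * ∑ l, star (x j l) * v l = v k := by
  simp_rw [Finset.mul_sum, ← mul_assoc]
  rw [Finset.sum_comm]
  simp_rw [← Finset.sum_mul, sum_mul_star_of_orthonormal x h]
  simp

/-- `x* A x` is self-conjugate for Hermitian `A`. -/
theorem star_lamI {n : ℕ} {AI : Matrix (Fin n) (Fin n) HQ} (hAI : ∀ i j, star (AI j i) = AI i j)
    (x : Fin n → Fin n → HQ) (i : Fin n) : star (lamI AI x i) = lamI AI x i := by
  simp only [lamI, Matrix.mulVec, dotProduct, star_sum, star_mul, star_star, Finset.mul_sum,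
    hAI]
  rw [Finset.sum_comm]
  simp only [mul_assoc]

/-- The first-order perturbation equation `A_st x_I + A_I x_st = x_st λ_I + x_I λ_st`. -/
theorem mulVec_xI_add {n : ℕ} (As AI : Matrix (Fin n) (Fin n) HQ)
    (hAI : ∀ i j, star (AI j i) = AI i j) (lamst : Fin n → ℝ) (x : Fin n → Fin n → HQ)
    (horth : ∀ i j, ∑ k, star (x i k) * x j k = if i = j then (1 : HQ) else 0)
    (heig : ∀ i, As.mulVec (x i) = fun k => (lamst i : HQ) * x i k)
    (hdist : ∀ i j, i ≠ j → lamst i ≠ lamst j) (i k : Fin n) :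
    As.mulVec (xI AI lamst x i) k + AI.mulVec (x i) k =
      x i k * lamI AI x i + xI AI lamst x i k * (lamst i : HQ) := by
  obtain ⟨r, hr⟩ : ∃ r : ℝ, lamI AI x i = (r : HQ) :=
    ⟨_, Quaternion.star_eq_self.mp (star_lamI hAI x i)⟩
  have hc : ∀ j ∈ Finset.univ.erase i,
      ∑ l, star (x j l) * (AI.mulVec (x i) l - lamI AI x i * x i l) =
        ∑ l, star (x j l) * AI.mulVec (x i) l := by
    intro j hj
    have h0 : ∑ l, star (x j l) * (lamI AI x i * x i l) = 0 := by
      simp_rw [hr, Quaternion.coe_mul_eq_smul, mul_smul_comm, ← Finset.smul_sum, horth]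
      simp [Finset.ne_of_mem_erase hj]
    simp only [mul_sub, Finset.sum_sub_distrib, h0, sub_zero]
  have hx : ∀ m, xI AI lamst x i m = ∑ j ∈ Finset.univ.erase i, (lamst i - lamst j)⁻¹ •
      (x j m * ∑ l, star (x j l) * AI.mulVec (x i) l) := fun m =>
    Finset.sum_congr rfl fun j hj => by rw [hc j hj]
  have hA : As.mulVec (xI AI lamst x i) k = ∑ j ∈ Finset.univ.erase i, (lamst i - lamst j)⁻¹ •
      (lamst j • (x j k * ∑ l, star (x j l) * AI.mulVec (x i) l)) := by
    have hk : ∀ j, ∑ m, As k m * x j m = (lamst j : HQ) * x j k := fun j => congrFun (heig j) k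
    change ∑ m, As k m * xI AI lamst x i m = _
    simp_rw [hx, Finset.mul_sum (Finset.univ.erase i)]
    rw [Finset.sum_comm]
    refine Finset.sum_congr rfl fun j _ => ?_
    simp_rw [mul_smul_comm, ← Finset.smul_sum, ← mul_assoc, ← Finset.sum_mul, hk,
      Quaternion.coe_mul_eq_smul, smul_mul_assoc]
  have hd : xI AI lamst x i k * (lamst i : HQ) - As.mulVec (xI AI lamst x i) k =
      ∑ j ∈ Finset.univ.erase i, x j k * ∑ l, star (x j l) * AI.mulVec (x i) l := by
    rw [hA, hx, Quaternion.mul_coe_eq_smul, Finset.smul_sum, ← Finset.sum_sub_distrib]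
    refine Finset.sum_congr rfl fun j hj => ?_
    have hne : lamst i - lamst j ≠ 0 := sub_ne_zero.mpr (hdist i j (Finset.ne_of_mem_erase hj).symm)
    rw [smul_comm, ← smul_sub, ← sub_smul, inv_smul_smul₀ hne]
  have he := sum_mul_inner_of_orthonormal x horth (AI.mulVec (x i)) k
  rw [← Finset.add_sum_erase _ _ (Finset.mem_univ i), ← hd] at he
  change x i k * lamI AI x i + _ = _ at he
  rw [← he]
  abel

/-- If `A = A_st + A_I ε` is Hermitian and `A_st` has an orthonormal basis of eigenvectors
`x_{st,i}` with pairwise distinct real eigenvalues `λ_{st,i}`, then for each `i`,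
`λ_{st,i} + λ_{I,i} ε` is an eigenvalue of `A` with eigenvector `x_{st,i} + x_{I,i} ε`. -/
theorem simple_spectrum_eigen_decomposition {n : ℕ}
    (A : Matrix (Fin n) (Fin n) DQ) (hA : A.IsHermitian)
    (lamst : Fin n → ℝ) (xst : Fin n → Fin n → HQ)
    (horth : ∀ i j, ∑ k, star (xst i k) * xst j k = if i = j then (1 : HQ) else 0)
    (heig : ∀ i, (Matrix.of fun i j => fst (A i j)).mulVec (xst i) =
      fun k => (lamst i : HQ) * xst i k)
    (hdist : ∀ i j, i ≠ j → lamst i ≠ lamst j) :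
    ∀ i, A.mulVec
        (fun k => (inl (xst i k) +
          inr (xI (Matrix.of fun i j => snd (A i j)) lamst xst i k) : DQ)) =
      fun k => ((inl (xst i k) +
          inr (xI (Matrix.of fun i j => snd (A i j)) lamst xst i k) : DQ)) *
        (inl (lamst i : HQ) + inr (lamI (Matrix.of fun i j => snd (A i j)) xst i)) := by
  intro i
  have hAI : ∀ i j, star (snd (A j i)) = snd (A i j) := fun i j => by
    have h : (inl (star (fst (A j i))) + inr (star (snd (A j i))) : DQ) = A i j :=
      congrFun (congrFun hA i) j
    simpa using congrArg snd h
  ext1 k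
  apply TrivSqZeroExt.ext
  · have h := congrFun (heig i) k
    simp only [Matrix.mulVec, dotProduct, Matrix.of_apply] at h
    simp [Matrix.mulVec, dotProduct, fst_sum, h, Quaternion.coe_commutes]
  · have h := mulVec_xI_add (Matrix.of fun i j => fst (A i j)) (Matrix.of fun i j => snd (A i j))
      hAI lamst xst horth heig hdist i k
    simp only [Matrix.mulVec, dotProduct, Matrix.of_apply, ← Finset.sum_add_distrib] at h
    simpa [Matrix.mulVec, dotProduct, snd_sum] using h
end

section
/- Let A be an n×n dual quaternion Hermitian matrix. Then there exist a unitary dual quaternion matrix U ∈ 𝔻ℚ^{n×n} (U* U = I_n) and dual numbers d_1 ≥ d_2 ≥ … ≥ d_n (in the total order on dual numbers, sorted first by strictly decreasing standard parts into groups, with infinitesimal parts decreasing within each group) such that U* A U = diag(d_1, …, d_n); each d_i is an eigenvalue of A with the i-th column of U as an associated eigenvector, i.e., A u_i = u_i d_i. Moreover, the diagonal matrix diag(d_1, …, d_n) is uniquely determined by A. -/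
open TrivSqZeroExt Matrix

theorem LinearMap.IsSymmetric.exists_joint_eigenvector {E : Type*} [NormedAddCommGroup E]
    [InnerProductSpace ℝ E] [FiniteDimensional ℝ E] [Nontrivial E] {S T : E →ₗ[ℝ] E}
    (hS : S.IsSymmetric) (hT : T.IsSymmetric) (hST : Commute S T) :
    ∃ (a b : ℝ) (x : E), x ≠ 0 ∧ S x = a • x ∧ T x = b • x := by
  by_contra! h
  have htop := hS.iSup_iSup_eigenspace_inf_eigenspace_eq_top_of_commute hT hST
  have hbot : ∀ a b : ℝ, Module.End.eigenspace S a ⊓ Module.End.eigenspace T b = ⊥ := by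
    intro a b
    refine (Submodule.eq_bot_iff _).2 fun x hx => ?_
    by_contra hx0
    exact h a b x hx0 (Module.End.mem_eigenspace_iff.1 hx.1) (Module.End.mem_eigenspace_iff.1 hx.2)
  simp only [hbot, iSup_bot] at htop
  exact bot_ne_top htop

namespace HQ

variable {ι : Type*} [Fintype ι]

theorem re_mul_comm (x y : HQ) : (x * y).re = (y * x).re := by
  simp only [Quaternion.re_mul]
  ring

theorem re_sum {κ : Type*} (s : Finset κ) (f : κ → HQ) : (∑ i ∈ s, f i).re = ∑ i ∈ s, (f i).re :=
  map_sum (QuaternionAlgebra.reₗ (-1 : ℝ) 0 (-1)) f s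

theorem star_real_smul {κ : Type*} (c : ℝ) (x : κ → HQ) : star (c • x) = c • star x := by
  ext1 i
  exact Quaternion.star_smul c (x i)

/-- Left multiplication by a quaternion matrix, as a real linear operator. -/
noncomputable def matrixEnd (A : Matrix ι ι HQ) :
    PiLp 2 (fun _ : ι => HQ) →ₗ[ℝ] PiLp 2 (fun _ : ι => HQ) where
  toFun x := WithLp.toLp 2 (A *ᵥ x.ofLp)
  map_add' x y := by simp [mulVec_add]
  map_smul' c x := by simp [mulVec_smul]

theorem matrixEnd_apply (A : Matrix ι ι HQ) (x : PiLp 2 (fun _ : ι => HQ)) :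
    matrixEnd A x = WithLp.toLp 2 (A *ᵥ x.ofLp) := rfl

theorem inner_eq_re_dotProduct (x y : PiLp 2 (fun _ : ι => HQ)) :
    inner ℝ x y = (star y.ofLp ⬝ᵥ x.ofLp).re := by
  simp only [PiLp.inner_apply, Quaternion.inner_def, dotProduct, re_sum, Pi.star_apply]
  exact Finset.sum_congr rfl fun i _ => re_mul_comm _ _

theorem star_dotProduct_mulVec {A : Matrix ι ι HQ} (hA : A.IsHermitian) (x y : ι → HQ) :
    star x ⬝ᵥ A *ᵥ y = star (A *ᵥ x) ⬝ᵥ y := by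
  rw [star_mulVec, hA.eq, dotProduct_mulVec]

theorem matrixEnd_isSymmetric {A : Matrix ι ι HQ} (hA : A.IsHermitian) :
    (matrixEnd A).IsSymmetric := by
  intro x y
  simp only [inner_eq_re_dotProduct, matrixEnd_apply]
  rw [star_dotProduct_mulVec hA]

theorem matrixEnd_commute {A B : Matrix ι ι HQ} (h : A * B = B * A) :
    Commute (matrixEnd A) (matrixEnd B) := by
  ext1 x
  simp [matrixEnd_apply, mulVec_mulVec, h]

/-- The real linear map sending a vector to its quaternionic inner products with a family. -/
noncomputable def pairing {k : ℕ} (v : Fin k → ι → HQ) :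
    PiLp 2 (fun _ : ι => HQ) →ₗ[ℝ] (Fin k → HQ) where
  toFun x i := star (v i) ⬝ᵥ x.ofLp
  map_add' x y := by ext1 i; simp [dotProduct_add]
  map_smul' c x := by ext1 i; simp [dotProduct_smul]

theorem mem_ker_pairing {k : ℕ} {v : Fin k → ι → HQ} {x : PiLp 2 (fun _ : ι => HQ)} :
    x ∈ LinearMap.ker (pairing v) ↔ ∀ i, star (v i) ⬝ᵥ x.ofLp = 0 := by
  simp [pairing, funext_iff]

theorem ker_pairing_invariant {k : ℕ} {v : Fin k → ι → HQ} {A : Matrix ι ι HQ}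
    (hA : A.IsHermitian) {a : Fin k → ℝ} (ha : ∀ i, A *ᵥ v i = a i • v i) :
    ∀ x ∈ LinearMap.ker (pairing v), matrixEnd A x ∈ LinearMap.ker (pairing v) := by
  intro x hx
  rw [mem_ker_pairing] at hx ⊢
  intro i
  rw [matrixEnd_apply, star_dotProduct_mulVec hA, ha, star_real_smul, smul_dotProduct, hx, smul_zero]

theorem star_dotProduct_self (x : ι → HQ) :
    star x ⬝ᵥ x = ((∑ i, Quaternion.normSq (x i) : ℝ) : HQ) := by
  simp only [dotProduct, Pi.star_apply, Quaternion.star_mul_self]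
  exact (map_sum (algebraMap ℝ HQ) _ _).symm

theorem exists_real_smul_unit {x : ι → HQ} (hx : x ≠ 0) :
    ∃ c : ℝ, star (c • x) ⬝ᵥ (c • x) = 1 := by
  set r : ℝ := ∑ i, Quaternion.normSq (x i) with hr
  have hr0 : 0 < r := by
    obtain ⟨i, hi⟩ := Function.ne_iff.1 hx
    refine Finset.sum_pos' (fun j _ => Quaternion.normSq_nonneg) ⟨i, Finset.mem_univ i, ?_⟩
    exact lt_of_le_of_ne Quaternion.normSq_nonneg (Quaternion.normSq_ne_zero.2 hi).symm
  refine ⟨(√r)⁻¹, ?_⟩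
  rw [star_real_smul, smul_dotProduct, dotProduct_smul, star_dotProduct_self, ← hr, smul_smul,
    ← mul_inv, Real.mul_self_sqrt hr0.le, Quaternion.smul_coe,
    inv_mul_cancel₀ hr0.ne', Quaternion.coe_one]

theorem exists_orthonormal_joint_eigenvectors {A P : Matrix ι ι HQ} (hA : A.IsHermitian)
    (hP : P.IsHermitian) (hAP : A * P = P * A) (k : ℕ) (hk : k ≤ Fintype.card ι) :
    ∃ (v : Fin k → ι → HQ) (a p : Fin k → ℝ),
      (∀ i j, star (v i) ⬝ᵥ v j = if i = j then 1 else 0) ∧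
      (∀ i, A *ᵥ v i = a i • v i) ∧ ∀ i, P *ᵥ v i = p i • v i := by
  induction k with
  | zero => exact ⟨finZeroElim, finZeroElim, finZeroElim, fun i => i.elim0, fun i => i.elim0,
      fun i => i.elim0⟩
  | succ k ih =>
    obtain ⟨v, a, p, hv, ha, hp⟩ := ih (by omega)
    have hne : LinearMap.ker (pairing v) ≠ ⊥ := by
      apply LinearMap.ker_ne_bot_of_finrank_lt
      rw [(WithLp.linearEquiv 2 ℝ (ι → HQ)).finrank_eq, Module.finrank_pi_fintype,
        Module.finrank_pi_fintype]
      simp only [Quaternion.finrank_eq_four, Finset.sum_const, Finset.card_univ,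
        Fintype.card_fin, smul_eq_mul]
      omega
    have : Nontrivial (LinearMap.ker (pairing v)) := Submodule.nontrivial_iff_ne_bot.2 hne
    obtain ⟨α, β, x, hx0, hxA, hxP⟩ := LinearMap.IsSymmetric.exists_joint_eigenvector
      ((matrixEnd_isSymmetric hA).restrict_invariant (ker_pairing_invariant hA ha))
      ((matrixEnd_isSymmetric hP).restrict_invariant (ker_pairing_invariant hP hp))
      (LinearMap.restrict_commute (matrixEnd_commute hAP) _ _)
    have hxA' : A *ᵥ x.1.ofLp = α • x.1.ofLp := congrArg (fun y => y.1.ofLp) hxA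
    have hxP' : P *ᵥ x.1.ofLp = β • x.1.ofLp := congrArg (fun y => y.1.ofLp) hxP
    have hx0' : x.1.ofLp ≠ 0 := fun h => hx0 (Subtype.ext (WithLp.ofLp_injective 2 h))
    obtain ⟨c, hc⟩ := exists_real_smul_unit hx0'
    have horth : ∀ i, star (v i) ⬝ᵥ (c • x.1.ofLp) = 0 := fun i => by
      rw [dotProduct_smul, mem_ker_pairing.1 x.2 i, smul_zero]
    have horth' : ∀ i, star (c • x.1.ofLp) ⬝ᵥ v i = 0 := fun i => by
      rw [star_dotProduct, horth, star_zero]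
    refine ⟨Fin.cons (c • x.1.ofLp) v, Fin.cons α a, Fin.cons β p, ?_, ?_, ?_⟩
    · intro i j
      refine Fin.cases ?_ (fun i => ?_) i <;> refine Fin.cases ?_ (fun j => ?_) j
      · simpa using hc
      · simpa [(Fin.succ_ne_zero _).symm] using horth' j
      · simpa using horth i
      · simpa using hv i j
    · refine Fin.cases ?_ fun i => ?_
      · simp only [Fin.cons_zero, mulVec_smul, hxA', smul_comm c α]
      · simpa using ha i
    · refine Fin.cases ?_ fun i => ?_
      · simp only [Fin.cons_zero, mulVec_smul, hxP', smul_comm c β]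
      · simpa using hp i

theorem exists_unitary_joint_diagonal {n : ℕ} {A P : Matrix (Fin n) (Fin n) HQ}
    (hA : A.IsHermitian) (hP : P.IsHermitian) (hAP : A * P = P * A) :
    ∃ (U : Matrix (Fin n) (Fin n) HQ) (a p : Fin n → ℝ), Uᴴ * U = 1 ∧
      A * U = U * diagonal (fun i => (a i : HQ)) ∧ P * U = U * diagonal (fun i => (p i : HQ)) := by
  obtain ⟨v, a, p, hv, ha, hp⟩ :=
    exists_orthonormal_joint_eigenvectors hA hP hAP n (Fintype.card_fin n).ge
  refine ⟨(Matrix.of v)ᵀ, a, p, ?_, ?_, ?_⟩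
  · ext1 i j
    rw [one_apply, ← hv i j]
    rfl
  · ext1 i j
    rw [mul_diagonal, ← Quaternion.coe_commutes, Quaternion.coe_mul_eq_smul]
    exact congrFun (ha j) i
  · ext1 i j
    rw [mul_diagonal, ← Quaternion.coe_commutes, Quaternion.coe_mul_eq_smul]
    exact congrFun (hp j) i

theorem exists_unitary_diagonal_on_eigenspaces {n : ℕ} {A B : Matrix (Fin n) (Fin n) HQ}
    (hA : A.IsHermitian) (hB : B.IsHermitian) :
    ∃ (U : Matrix (Fin n) (Fin n) HQ) (a p : Fin n → ℝ), Uᴴ * U = 1 ∧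
      Uᴴ * A * U = diagonal (fun i => (a i : HQ)) ∧
      ∀ i j, a i = a j → (Uᴴ * B * U) i j = if i = j then (p i : HQ) else 0 := by
  obtain ⟨V, c, -, hV, hAV, -⟩ := exists_unitary_joint_diagonal hA hA rfl
  set C := Vᴴ * B * V with hC
  have hCh : C.IsHermitian := isHermitian_conjTranspose_mul_mul V hB
  set D : Matrix (Fin n) (Fin n) HQ := diagonal fun i => (c i : HQ) with hD
  have hDh : D.IsHermitian := by
    rw [hD, isHermitian_diagonal_iff]
    exact fun i => Quaternion.star_coe (c i)
  set P : Matrix (Fin n) (Fin n) HQ := Matrix.of fun i j => if c i = c j then C i j else 0 with hP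
  have hPh : P.IsHermitian := by
    ext1 i j
    simp only [hP, conjTranspose_apply, of_apply, eq_comm (a := c j), apply_ite star, star_zero,
      hCh.apply]
  have hDP : D * P = P * D := by
    ext1 i j
    simp only [hD, diagonal_mul, mul_diagonal, hP, of_apply]
    split_ifs with h
    · rw [h, Quaternion.coe_commutes]
    · simp
  obtain ⟨W, a, p, hW, hDW, hPW⟩ := exists_unitary_joint_diagonal hDh hPh hDP
  refine ⟨V * W, a, p, ?_, ?_, ?_⟩
  · rw [conjTranspose_mul, Matrix.mul_assoc, ← Matrix.mul_assoc Vᴴ, hV, Matrix.one_mul, hW]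
  · calc (V * W)ᴴ * A * (V * W) = Wᴴ * (Vᴴ * (A * V)) * W := by
          simp only [conjTranspose_mul, Matrix.mul_assoc]
      _ = Wᴴ * (D * W) := by rw [hAV, ← Matrix.mul_assoc Vᴴ, hV, Matrix.one_mul, Matrix.mul_assoc]
      _ = _ := by rw [hDW, ← Matrix.mul_assoc, hW, Matrix.one_mul]
  · intro i j hij
    have hsupp : ∀ k l, W k l ≠ 0 → c k = a l := by
      intro k l hkl
      have h := congrFun₂ hDW k l
      rw [hD, diagonal_mul, mul_diagonal, ← Quaternion.coe_commutes] at h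
      exact Quaternion.coe_injective (mul_right_cancel₀ hkl h)
    calc ((V * W)ᴴ * B * (V * W)) i j = (Wᴴ * (C * W)) i j := by
          simp only [hC, conjTranspose_mul, Matrix.mul_assoc]
      _ = (Wᴴ * (P * W)) i j := by
          simp only [mul_apply (M := Wᴴ), mul_apply (N := W), Finset.mul_sum]
          refine Finset.sum_congr rfl fun k _ => Finset.sum_congr rfl fun l _ => ?_
          by_cases hk : W k i = 0
          · simp [conjTranspose_apply, hk]
          by_cases hl : W l j = 0
          · simp [hl]
          · simp [hP, hsupp k i hk, hsupp l j hl, hij]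
      _ = _ := by
          rw [hPW, ← Matrix.mul_assoc, hW, Matrix.one_mul, diagonal_apply]

theorem exists_unitary_sorted_diagonal_on_eigenspaces {n : ℕ} {A B : Matrix (Fin n) (Fin n) HQ}
    (hA : A.IsHermitian) (hB : B.IsHermitian) :
    ∃ (U : Matrix (Fin n) (Fin n) HQ) (a p : Fin n → ℝ), Uᴴ * U = 1 ∧
      Uᴴ * A * U = diagonal (fun i => (a i : HQ)) ∧
      (∀ i j, a i = a j → (Uᴴ * B * U) i j = if i = j then (p i : HQ) else 0) ∧
      Antitone fun i => toLex (a i, p i) := by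
  obtain ⟨U, a, p, hU, hAU, hBU⟩ := exists_unitary_diagonal_on_eigenspaces hA hB
  set σ := Tuple.sort fun i => OrderDual.toDual (toLex (a i, p i))
  have hconj : ∀ M : Matrix (Fin n) (Fin n) HQ,
      (U.submatrix id σ)ᴴ * M * U.submatrix id σ = (Uᴴ * M * U).submatrix σ σ := fun M => by
    rw [conjTranspose_submatrix]
    rfl
  refine ⟨U.submatrix id σ, a ∘ σ, p ∘ σ, ?_, ?_, ?_, ?_⟩
  · have h := hconj 1
    rwa [Matrix.mul_one, Matrix.mul_one, hU, submatrix_one_equiv] at h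
  · rw [hconj, hAU, submatrix_diagonal_equiv]
    rfl
  · intro i j hij
    rw [hconj, submatrix_apply, hBU _ _ hij]
    simp
  · exact fun i j hij =>
      Tuple.monotone_sort (fun i => OrderDual.toDual (toLex (a i, p i))) hij

end HQ

theorem Antitone.le_of_doublyStochastic {n : ℕ} {α : Type*} [LinearOrder α] {f g : Fin n → α}
    (hf : Antitone f) (hg : Antitone g) {s : Fin n → Fin n → ℝ} (hs : ∀ i j, 0 ≤ s i j)
    (hrow : ∀ i, ∑ j, s i j = 1) (hcol : ∀ j, ∑ i, s i j = 1)
    (hfg : ∀ i j, s i j ≠ 0 → f i = g j) (k : Fin n) : f k ≤ g k := by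
  by_contra! hk
  have hzero : ∀ i ≤ k, ∀ j, k ≤ j → s i j = 0 := by
    intro i hi j hj
    by_contra h
    exact ((hg hj).trans_lt (hk.trans_le (hf hi))).ne' (hfg i j h)
  have hle : ∑ i ∈ Finset.Iic k, ∑ j, s i j ≤ ∑ j ∈ Finset.Iio k, ∑ i, s i j := by
    calc ∑ i ∈ Finset.Iic k, ∑ j, s i j = ∑ i ∈ Finset.Iic k, ∑ j ∈ Finset.Iio k, s i j := by
          refine Finset.sum_congr rfl fun i hi => (Finset.sum_subset (Finset.subset_univ _) ?_).symm
          intro j _ hj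
          exact hzero i (Finset.mem_Iic.1 hi) j (by simpa using hj)
      _ = ∑ j ∈ Finset.Iio k, ∑ i ∈ Finset.Iic k, s i j := Finset.sum_comm
      _ ≤ _ := Finset.sum_le_sum fun j _ =>
          Finset.sum_le_sum_of_subset_of_nonneg (Finset.subset_univ _) fun i _ _ => hs i j
  simp only [hrow, hcol, Finset.sum_const, Fin.card_Iic, Fin.card_Iio, nsmul_eq_mul, mul_one,
    Nat.cast_le] at hle
  omega

theorem Antitone.eq_of_doublyStochastic {n : ℕ} {α : Type*} [LinearOrder α] {f g : Fin n → α}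
    (hf : Antitone f) (hg : Antitone g) {s : Fin n → Fin n → ℝ} (hs : ∀ i j, 0 ≤ s i j)
    (hrow : ∀ i, ∑ j, s i j = 1) (hcol : ∀ j, ∑ i, s i j = 1)
    (hfg : ∀ i j, s i j ≠ 0 → f i = g j) : f = g :=
  funext fun k => le_antisymm (hf.le_of_doublyStochastic hg hs hrow hcol hfg k)
    (hg.le_of_doublyStochastic hf (fun i j => hs j i) hcol hrow (fun i j h => (hfg j i h).symm) k)

namespace DQ

variable {m n l : Type*}

/-- The dual quaternion matrix with given standard and infinitesimal parts. -/
def ofParts (X Y : Matrix m n HQ) : Matrix m n DQ := Matrix.of fun i j => (X i j, Y i j)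

theorem fst_ofParts (X Y : Matrix m n HQ) (i : m) (j : n) : fst (ofParts X Y i j) = X i j := rfl

theorem snd_ofParts (X Y : Matrix m n HQ) (i : m) (j : n) : snd (ofParts X Y i j) = Y i j := rfl

theorem exists_eq_ofParts (A : Matrix m n DQ) : ∃ X Y, A = ofParts X Y :=
  ⟨A.map fst, A.map snd, rfl⟩

theorem ofParts_inj {X Y Z W : Matrix m n HQ} : ofParts X Y = ofParts Z W ↔ X = Z ∧ Y = W :=
  ⟨fun h => ⟨congrArg (fun M => M.map fst) h, congrArg (fun M => M.map snd) h⟩,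
    fun h => by rw [h.1, h.2]⟩

theorem ofParts_mul [Fintype n] (X Y : Matrix m n HQ) (Z W : Matrix n l HQ) :
    ofParts X Y * ofParts Z W = ofParts (X * Z) (X * W + Y * Z) := by
  ext1 i j
  refine TrivSqZeroExt.ext ?_ ?_
  · rw [fst_ofParts, mul_apply, fst_sum, mul_apply]
    rfl
  · rw [snd_ofParts, mul_apply, snd_sum, Matrix.add_apply, mul_apply, mul_apply, ← Finset.sum_add_distrib]
    rfl

theorem ofParts_conjTranspose (X Y : Matrix m n HQ) : (ofParts X Y)ᴴ = ofParts Xᴴ Yᴴ := by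
  ext1 i j
  exact TrivSqZeroExt.ext (add_zero _) (zero_add _)

theorem one_eq_ofParts [DecidableEq n] : (1 : Matrix n n DQ) = ofParts 1 0 := by
  ext1 i j
  refine TrivSqZeroExt.ext ?_ ?_ <;> by_cases h : i = j <;>
    simp [fst_ofParts, snd_ofParts, one_apply, h]

theorem diagonal_eq_ofParts [DecidableEq n] (d : n → DQ) :
    diagonal d = ofParts (diagonal fun i => fst (d i)) (diagonal fun i => snd (d i)) := by
  ext1 i j
  refine TrivSqZeroExt.ext ?_ ?_ <;> by_cases h : i = j <;>
    simp [fst_ofParts, snd_ofParts, h]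

theorem conjTranspose_mul_self_eq_one_iff [Fintype n] [DecidableEq n] {X Y : Matrix n n HQ} :
    (ofParts X Y)ᴴ * ofParts X Y = 1 ↔ Xᴴ * X = 1 ∧ Xᴴ * Y + Yᴴ * X = 0 := by
  rw [ofParts_conjTranspose, ofParts_mul, one_eq_ofParts, ofParts_inj]

theorem mul_conjTranspose_self [Fintype n] [DecidableEq n] {U : Matrix n n DQ}
    (hU : Uᴴ * U = 1) : U * Uᴴ = 1 := by
  obtain ⟨X, Y, rfl⟩ := exists_eq_ofParts U
  obtain ⟨hX, hXY⟩ := conjTranspose_mul_self_eq_one_iff.1 hU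
  have hX' : X * Xᴴ = 1 := mul_eq_one_comm.1 hX
  rw [ofParts_conjTranspose, ofParts_mul, one_eq_ofParts, ofParts_inj]
  refine ⟨hX', ?_⟩
  calc X * Yᴴ + Y * Xᴴ = X * Yᴴ * (X * Xᴴ) + X * Xᴴ * (Y * Xᴴ) := by
        rw [hX', Matrix.mul_one, Matrix.one_mul]
    _ = X * (Xᴴ * Y + Yᴴ * X) * Xᴴ := by
        simp only [Matrix.mul_add, Matrix.add_mul, Matrix.mul_assoc]
        exact add_comm _ _
    _ = 0 := by rw [hXY, Matrix.mul_zero, Matrix.zero_mul]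

theorem sum_normSq_col [Fintype n] [DecidableEq n] {X : Matrix n n HQ} (hX : Xᴴ * X = 1) (j : n) :
    ∑ i, Quaternion.normSq (X i j) = 1 := by
  have h := congrFun₂ hX j j
  rw [one_apply_eq] at h
  exact Quaternion.coe_injective ((HQ.star_dotProduct_self fun i => X i j).symm.trans h)

theorem antitone_toLex {n : ℕ} {d : Fin n → DQ} (hd : ∀ i j : Fin n, i ≤ j → DQ.le (d j) (d i)) :
    Antitone fun i => toLex ((fst (d i)).re, (snd (d i)).re) :=
  fun i j hij => Prod.Lex.toLex_le_toLex.2 (hd i j hij)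

theorem IsDualNum.exists_coe {q : DQ} (h : IsDualNum q) :
    fst q = ((fst q).re : HQ) ∧ snd q = ((snd q).re : HQ) := by
  obtain ⟨a, b, rfl⟩ := h
  simp

theorem IsDualNum.ext {p q : DQ} (hp : IsDualNum p) (hq : IsDualNum q)
    (h₁ : (fst p).re = (fst q).re) (h₂ : (snd p).re = (snd q).re) : p = q :=
  TrivSqZeroExt.ext (by rw [hp.exists_coe.1, hq.exists_coe.1, h₁])
    (by rw [hp.exists_coe.2, hq.exists_coe.2, h₂])

theorem eq_of_mul_eq_mul {d e x : DQ} (he : IsDualNum e) (hx : Appreciable x)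
    (h : d * x = x * e) : d = e := by
  have h₁ := congrArg fst h
  rw [fst_mul, fst_mul, he.exists_coe.1, ← Quaternion.coe_commutes, ← he.exists_coe.1] at h₁
  have h₁' : fst d = fst e := mul_right_cancel₀ hx h₁
  have h₂ := congrArg snd h
  have hcomm₁ : fst e * snd x = snd x * fst e := by
    rw [he.exists_coe.1, Quaternion.coe_commutes]
  have hcomm₂ : snd e * fst x = fst x * snd e := by
    rw [he.exists_coe.2, Quaternion.coe_commutes]
  rw [DualNumber.snd_mul, DualNumber.snd_mul, h₁', hcomm₁, ← hcomm₂, add_comm] at h₂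
  exact TrivSqZeroExt.ext h₁' (mul_right_cancel₀ hx (add_right_cancel h₂))

theorem diagonal_unique {n : ℕ} {A U V : Matrix (Fin n) (Fin n) DQ} {d e : Fin n → DQ}
    (hU : Uᴴ * U = 1) (hV : Vᴴ * V = 1) (hd : ∀ i, IsDualNum (d i)) (he : ∀ i, IsDualNum (e i))
    (hd' : ∀ i j : Fin n, i ≤ j → DQ.le (d j) (d i))
    (he' : ∀ i j : Fin n, i ≤ j → DQ.le (e j) (e i))
    (hAU : Uᴴ * A * U = diagonal d) (hAV : Vᴴ * A * V = diagonal e) : d = e := by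
  have hM : diagonal d * (Uᴴ * V) = Uᴴ * V * diagonal e := by
    calc diagonal d * (Uᴴ * V) = Uᴴ * A * (U * Uᴴ) * V := by
          rw [← hAU]
          simp only [Matrix.mul_assoc]
      _ = Uᴴ * (V * Vᴴ) * A * V := by
          rw [mul_conjTranspose_self hU, mul_conjTranspose_self hV, Matrix.mul_one, Matrix.mul_one]
      _ = _ := by
          rw [← hAV]
          simp only [Matrix.mul_assoc]
  obtain ⟨X, X', rfl⟩ := exists_eq_ofParts U
  obtain ⟨Y, Y', rfl⟩ := exists_eq_ofParts V
  have hX := (conjTranspose_mul_self_eq_one_iff.1 hU).1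
  have hY := (conjTranspose_mul_self_eq_one_iff.1 hV).1
  have hX' : X * Xᴴ = 1 := mul_eq_one_comm.1 hX
  have hXY : (Xᴴ * Y)ᴴ * (Xᴴ * Y) = 1 := by
    rw [conjTranspose_mul, conjTranspose_conjTranspose, Matrix.mul_assoc, ← Matrix.mul_assoc X, hX',
      Matrix.one_mul, hY]
  have hXY' : (Xᴴ * Y)ᴴᴴ * (Xᴴ * Y)ᴴ = 1 := by
    rw [conjTranspose_conjTranspose]
    exact mul_eq_one_comm.1 hXY
  have key := (antitone_toLex hd').eq_of_doublyStochastic (antitone_toLex he')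
    (s := fun i j => Quaternion.normSq ((Xᴴ * Y) i j)) (fun _ _ => Quaternion.normSq_nonneg)
    (fun i => by simpa [conjTranspose_apply] using sum_normSq_col hXY' i)
    (sum_normSq_col hXY) (fun i j hij => by
      have h := congrFun₂ hM i j
      rw [diagonal_mul, mul_diagonal, ofParts_conjTranspose, ofParts_mul] at h
      have hne : Appreciable (ofParts (Xᴴ * Y) (Xᴴ * Y' + X'ᴴ * Y) i j) :=
        Quaternion.normSq_ne_zero.1 hij
      rw [eq_of_mul_eq_mul (he j) hne h])
  funext i
  have hi := Prod.ext_iff.1 (toLex.injective (congrFun key i))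
  exact (hd i).ext (he i) hi.1 hi.2

/-- The skew-Hermitian correction cancelling the entries of `C` outside the diagonal blocks on
which `a` is constant. -/
noncomputable def correction (a : n → ℝ) (C : Matrix n n HQ) : Matrix n n HQ :=
  Matrix.of fun i j => (a j - a i)⁻¹ • C i j

theorem correction_conjTranspose (a : n → ℝ) {C : Matrix n n HQ} (hC : C.IsHermitian) :
    (correction a C)ᴴ = -correction a C := by
  ext1 i j
  simp only [correction, conjTranspose_apply, of_apply, Quaternion.star_smul, hC.apply, Matrix.neg_apply]
  rw [← neg_sub (a j), inv_neg, neg_smul]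

theorem correction_cancel [Fintype n] [DecidableEq n] {a p : n → ℝ} {C : Matrix n n HQ}
    (hC : ∀ i j, a i = a j → C i j = if i = j then (p i : HQ) else 0) :
    (diagonal fun i => (a i : HQ)) * correction a C + C
      - correction a C * (diagonal fun i => (a i : HQ)) = diagonal fun i => (p i : HQ) := by
  ext1 i j
  rw [Matrix.sub_apply, Matrix.add_apply, diagonal_mul, mul_diagonal, ← Quaternion.coe_commutes, diagonal_apply]
  simp only [correction, of_apply, Quaternion.coe_mul_eq_smul, smul_smul]
  by_cases h : a i = a j
  · simp [h, hC i j h]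
  · have hij : i ≠ j := fun hij => h (congrArg a hij)
    have h' : a j - a i ≠ 0 := sub_ne_zero.2 (Ne.symm h)
    rw [if_neg hij, add_sub_right_comm, ← sub_smul, ← sub_mul, ← neg_sub (a j), neg_mul,
      mul_inv_cancel₀ h', neg_smul, one_smul, neg_add_cancel]

theorem exists_unitary_sorted_diagonal {n : ℕ} {A : Matrix (Fin n) (Fin n) DQ}
    (hA : A.IsHermitian) :
    ∃ (U : Matrix (Fin n) (Fin n) DQ) (d : Fin n → DQ), Uᴴ * U = 1 ∧
      (∀ i, DQ.IsDualNum (d i)) ∧ (∀ i j : Fin n, i ≤ j → DQ.le (d j) (d i)) ∧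
      Uᴴ * A * U = diagonal d := by
  obtain ⟨A₀, A₁, rfl⟩ := exists_eq_ofParts A
  rw [IsHermitian, ofParts_conjTranspose, ofParts_inj] at hA
  obtain ⟨U, a, p, hU, hAU, hBU, hanti⟩ :=
    HQ.exists_unitary_sorted_diagonal_on_eigenspaces (A := A₀) (B := A₁) hA.1 hA.2
  set X := correction a (Uᴴ * A₁ * U) with hX
  have hXh : Xᴴ = -X := correction_conjTranspose a (isHermitian_conjTranspose_mul_mul U hA.2)
  refine ⟨ofParts U (U * X), fun i => inl (a i : HQ) + inr (p i : HQ), ?_,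
    fun i => ⟨a i, p i, rfl⟩, ?_, ?_⟩
  · rw [conjTranspose_mul_self_eq_one_iff]
    refine ⟨hU, ?_⟩
    rw [conjTranspose_mul, Matrix.mul_assoc, hU, ← Matrix.mul_assoc, hU, Matrix.one_mul,
      Matrix.mul_one, hXh, add_neg_cancel]
  · intro i j hij
    have h := Prod.Lex.toLex_le_toLex.1 (hanti hij)
    simpa [DQ.le] using h
  · rw [diagonal_eq_ofParts, ofParts_conjTranspose, ofParts_mul, ofParts_mul, ofParts_inj]
    simp only [fst_add, snd_add, fst_inl, fst_inr, snd_inl, snd_inr, add_zero, zero_add]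
    refine ⟨hAU, ?_⟩
    rw [← correction_cancel hBU, ← hX, ← hAU, conjTranspose_mul, hXh]
    simp only [Matrix.add_mul, Matrix.mul_assoc, Matrix.neg_mul]
    abel

theorem mulVec_col_of_conj_eq_diagonal [Fintype n] [DecidableEq n] {A U : Matrix n n DQ}
    {d : n → DQ} (hU : Uᴴ * U = 1) (h : Uᴴ * A * U = diagonal d) (i : n) :
    A *ᵥ (fun k => U k i) = fun k => U k i * d i := by
  have hAU : A * U = U * diagonal d := by
    rw [← h, Matrix.mul_assoc, ← Matrix.mul_assoc, mul_conjTranspose_self hU, Matrix.one_mul]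
  funext k
  rw [← mul_diagonal, ← hAU]
  rfl

theorem exists_appreciable_of_unitary [Fintype n] [DecidableEq n] {U : Matrix n n DQ}
    (hU : Uᴴ * U = 1) (i : n) : ∃ k, fst (U k i) ≠ 0 := by
  obtain ⟨X, Y, rfl⟩ := exists_eq_ofParts U
  by_contra! h
  have := sum_normSq_col (conjTranspose_mul_self_eq_one_iff.1 hU).1 i
  simp_all [fst_ofParts]

end DQ


/-- Unitary decomposition of a dual quaternion Hermitian matrix: there are a unitary `U` and
decreasingly ordered dual numbers `d₁ ≥ … ≥ dₙ` with `U* A U = diag(d₁, …, dₙ)`; each `dᵢ`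
is an eigenvalue of `A` with the `i`-th column of `U` as an associated (appreciable)
eigenvector; and the diagonal matrix is uniquely determined by `A`. -/
theorem hermitian_unitary_decomposition {n : ℕ}
    (A : Matrix (Fin n) (Fin n) DQ) (hA : A.IsHermitian) :
    ∃ (U : Matrix (Fin n) (Fin n) DQ) (d : Fin n → DQ),
      Uᴴ * U = 1 ∧
      (∀ i, DQ.IsDualNum (d i)) ∧
      (∀ i j : Fin n, i ≤ j → DQ.le (d j) (d i)) ∧
      Uᴴ * A * U = Matrix.diagonal d ∧
      (∀ i, (∃ k, fst (U k i) ≠ 0) ∧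
        A.mulVec (fun k => U k i) = fun k => U k i * d i) ∧
      (∀ (V : Matrix (Fin n) (Fin n) DQ) (e : Fin n → DQ),
        Vᴴ * V = 1 → (∀ i, DQ.IsDualNum (e i)) →
        (∀ i j : Fin n, i ≤ j → DQ.le (e j) (e i)) →
        Vᴴ * A * V = Matrix.diagonal e → e = d) := by
  obtain ⟨U, d, hU, hd, hd', hAU⟩ := DQ.exists_unitary_sorted_diagonal hA
  exact ⟨U, d, hU, hd, hd', hAU, fun i => ⟨DQ.exists_appreciable_of_unitary hU i,
    DQ.mulVec_col_of_conj_eq_diagonal hU hAU i⟩,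
    fun V e hV he he' hAV => (DQ.diagonal_unique hU hV hd he hd' he' hAU hAV).symm⟩
end

section
/- Let A be an n×n dual quaternion Hermitian matrix. Then: (i) A is positive semidefinite if and only if every eigenvalue of A (every dual number λ with A x = x λ for some appreciable x ∈ 𝔻ℚ^n) is a nonnegative dual number; (ii) A is positive definite if and only if every eigenvalue of A is a positive and appreciable dual number. -/
open TrivSqZeroExt Matrix

section SymmetricPair

variable {E : Type*} [NormedAddCommGroup E] [InnerProductSpace ℝ E]

open Module.End

/-- A symmetric operator on a nontrivial finite-dimensional space has an eigenvector whose
eigenvalue is a lower bound for the Rayleigh quotient. -/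
theorem LinearMap.IsSymmetric.exists_min_eigenvector [FiniteDimensional ℝ E] [Nontrivial E]
    {S : E →ₗ[ℝ] E} (hS : S.IsSymmetric) :
    ∃ (a : ℝ) (u : E), u ≠ 0 ∧ S u = a • u ∧ ∀ w, a * ‖w‖ ^ 2 ≤ inner ℝ (S w) w := by
  obtain ⟨u, hu⟩ := hS.hasEigenvalue_iInf_of_finiteDimensional.exists_hasEigenvector
  refine ⟨_, u, hu.2, hu.apply_eq_smul, fun w => ?_⟩
  by_cases hw : w = 0
  · simp [hw]
  have hpos : 0 < ‖w‖ ^ 2 := by positivity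
  rw [← le_div_iff₀ hpos]
  have hbdd : BddBelow (Set.range fun x : {x : E // x ≠ 0} =>
      RCLike.re (inner ℝ (S x) (x : E)) / ‖(x : E)‖ ^ 2) := by
    refine ⟨-‖S.toContinuousLinearMap‖, ?_⟩
    rintro _ ⟨⟨x, hx⟩, rfl⟩
    have hx' : 0 < ‖x‖ ^ 2 := by positivity
    have h₁ := (abs_le.1 (abs_real_inner_le_norm (S x) x)).1
    have h₂ : ‖S x‖ ≤ ‖S.toContinuousLinearMap‖ * ‖x‖ := S.toContinuousLinearMap.le_opNorm x
    simp only [RCLike.re_to_real]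
    rw [le_div_iff₀ hx']
    nlinarith [norm_nonneg x]
  exact ciInf_le hbdd ⟨w, hw⟩

/-- A positive semidefinite symmetric operator kills every vector on which its form vanishes. -/
theorem LinearMap.IsSymmetric.apply_eq_zero_of_inner_eq_zero {S : E →ₗ[ℝ] E}
    (hS : S.IsSymmetric) (hpos : ∀ w, 0 ≤ inner ℝ (S w) w) {w : E}
    (hw : inner ℝ (S w) w = 0) : S w = 0 := by
  have h := discrim_le_zero (a := inner ℝ (S (S w)) (S w)) (b := 2 * ‖S w‖ ^ 2) (c := 0)
    fun t => by
      have h₁ := hpos (w + t • S w)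
      have h₂ : inner ℝ (S (S w)) w = ‖S w‖ ^ 2 := by rw [hS, real_inner_self_eq_norm_sq]
      simp only [map_add, map_smul, inner_add_left, inner_add_right, real_inner_smul_left,
        real_inner_smul_right, hw, h₂, real_inner_self_eq_norm_sq] at h₁
      linarith
  have h₃ : ‖S w‖ ^ 2 = 0 := by
    simp only [discrim] at h
    nlinarith [sq_nonneg (2 * ‖S w‖ ^ 2)]
  simpa using h₃

/-- The pencil `S + T ε` of symmetric operators has an eigenvalue `a + b ε` with `a` minimal for
`S`, and `b` minimal for `T` on the `a`-eigenspace of `S`. -/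
theorem LinearMap.IsSymmetric.exists_min_dual_eigenvector [FiniteDimensional ℝ E] [Nontrivial E]
    {S T : E →ₗ[ℝ] E}
    (hS : S.IsSymmetric) (hT : T.IsSymmetric) :
    ∃ (a b : ℝ) (u v : E), u ≠ 0 ∧ S u = a • u ∧ S v + T u = a • v + b • u ∧
      (∀ w, a * ‖w‖ ^ 2 ≤ inner ℝ (S w) w) ∧
      ∀ w, S w = a • w → b * ‖w‖ ^ 2 ≤ inner ℝ (T w) w := by
  obtain ⟨a, u₀, hu₀, hSu₀, ha⟩ := hS.exists_min_eigenvector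
  let K := eigenspace S a
  have : Nontrivial K := ⟨⟨⟨u₀, mem_eigenspace_iff.2 hSu₀⟩, 0, by simpa [Subtype.ext_iff] using hu₀⟩⟩
  let P : E →ₗ[ℝ] K := K.orthogonalProjectionOnto.toLinearMap
  have hP (x : E) (w : K) : inner ℝ (P x) w = inner ℝ x (w : E) :=
    Submodule.inner_orthogonalProjectionOnto_eq_of_mem_right w x
  let T' : K →ₗ[ℝ] K := P ∘ₗ T ∘ₗ K.subtype
  have hT' (x w : K) : inner ℝ (T' x) w = inner ℝ (T x) (w : E) := hP (T x) w
  have hT's : T'.IsSymmetric := fun x w => by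
    rw [hT', real_inner_comm (T' w) x, hT', real_inner_comm (x : E)]
    exact hT x w
  obtain ⟨b, u, hu, hTu, hb⟩ := hT's.exists_min_eigenvector
  have hS' : (S - a • LinearMap.id).IsSymmetric := fun x y => by
    simp [inner_sub_left, inner_sub_right, real_inner_smul_left, real_inner_smul_right, hS x y]
  have hmem : b • (u : E) - T u ∈ LinearMap.range (S - a • LinearMap.id) := by
    rw [← Submodule.orthogonal_orthogonal (LinearMap.range (S - a • LinearMap.id)),
      hS'.orthogonal_range, Submodule.mem_orthogonal']
    intro w hw
    have hwK : w ∈ K := mem_eigenspace_iff.2 (by simpa [sub_eq_zero] using hw)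
    have h := hT' u ⟨w, hwK⟩
    rw [hTu] at h
    rw [inner_sub_left, ← h, sub_eq_zero]
    simp [real_inner_smul_left]
  obtain ⟨v, hv⟩ := hmem
  refine ⟨a, b, u, v, by simpa using hu, mem_eigenspace_iff.1 u.2, ?_, ha, fun w hw => ?_⟩
  · have hv' : S v - a • v = b • (u : E) - T u := by simpa using hv
    rw [sub_eq_sub_iff_add_eq_add] at hv'
    rw [hv', add_comm]
  · have h := hb ⟨w, mem_eigenspace_iff.2 hw⟩
    rwa [hT'] at h

end SymmetricPair

/-- The real inner product space of quaternion vectors. -/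
abbrev QVec (n : ℕ) := PiLp 2 fun _ : Fin n => HQ

/-- The real-linear operator on quaternion vectors given by a quaternion matrix. -/
noncomputable def Matrix.qvecLin {n : ℕ} (M : Matrix (Fin n) (Fin n) HQ) : QVec n →ₗ[ℝ] QVec n where
  toFun u := WithLp.toLp 2 (M.mulVec u)
  map_add' u v := by
    ext1 i
    simp [Matrix.mulVec, dotProduct, mul_add, Finset.sum_add_distrib]
  map_smul' c u := by
    ext1 i
    simp [Matrix.mulVec, dotProduct, Finset.smul_sum]

theorem Quaternion.re_mul_comm_s15 (p q : HQ) : (p * q).re = (q * p).re := by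
  simp only [Quaternion.re_mul]
  ring

theorem Quaternion.re_sum_s15 {ι : Type*} (s : Finset ι) (f : ι → HQ) :
    (∑ i ∈ s, f i).re = ∑ i ∈ s, (f i).re :=
  map_sum (⟨⟨fun q : HQ => q.re, rfl⟩, fun _ _ => rfl⟩ : HQ →+ ℝ) f s

theorem QVec.inner_eq_re {n : ℕ} (u w : QVec n) :
    inner ℝ u w = (∑ i, star (w i) * u i).re := by
  simp only [PiLp.inner_apply, Quaternion.inner_def, Quaternion.re_sum_s15]
  exact Finset.sum_congr rfl fun i _ => Quaternion.re_mul_comm_s15 _ _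

theorem Matrix.qvecLin_isSymmetric {n : ℕ} {M : Matrix (Fin n) (Fin n) HQ}
    (hM : ∀ i j, star (M j i) = M i j) : M.qvecLin.IsSymmetric := by
  intro u w
  simp only [QVec.inner_eq_re, Matrix.qvecLin, LinearMap.coe_mk, AddHom.coe_mk, Matrix.mulVec,
    dotProduct, Finset.mul_sum, star_sum, Finset.sum_mul, star_mul]
  rw [Finset.sum_comm]
  simp only [hM, mul_assoc]

namespace DQ

variable {n : ℕ}

/-- The vector of standard parts. -/
noncomputable def stVec (x : Fin n → DQ) : QVec n := WithLp.toLp 2 fun i => fst (x i)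

/-- The vector of infinitesimal parts. -/
noncomputable def infVec (x : Fin n → DQ) : QVec n := WithLp.toLp 2 fun i => snd (x i)

/-- The operator given by the standard part of a matrix. -/
noncomputable def stLin (A : Matrix (Fin n) (Fin n) DQ) : QVec n →ₗ[ℝ] QVec n :=
  Matrix.qvecLin (A.map fst)

/-- The operator given by the infinitesimal part of a matrix. -/
noncomputable def infLin (A : Matrix (Fin n) (Fin n) DQ) : QVec n →ₗ[ℝ] QVec n :=
  Matrix.qvecLin (A.map snd)

theorem fst_star_s15 (q : DQ) : fst (star q) = star (fst q) := by
  change fst (inl (star (fst q)) + inr (star (snd q))) = _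
  simp

theorem snd_star_s15 (q : DQ) : snd (star q) = star (snd q) := by
  change snd (inl (star (fst q)) + inr (star (snd q))) = _
  simp

theorem zero_le_iff (q : DQ) :
    DQ.le 0 q ↔ 0 < (fst q).re ∨ (0 = (fst q).re ∧ 0 ≤ (snd q).re) :=
  Iff.rfl

theorem zero_lt_iff (q : DQ) :
    DQ.lt 0 q ↔ 0 < (fst q).re ∨ (0 = (fst q).re ∧ 0 < (snd q).re) :=
  Iff.rfl

theorem re_fst_inl_add_inr (a b : ℝ) : (fst (inl (a : HQ) + inr (b : HQ) : DQ)).re = a := by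
  rw [fst_add, fst_inl, fst_inr, add_zero, Quaternion.re_coe]

theorem re_snd_inl_add_inr (a b : ℝ) : (snd (inl (a : HQ) + inr (b : HQ) : DQ)).re = b := by
  rw [snd_add, snd_inl, snd_inr, zero_add, Quaternion.re_coe]

theorem fst_ne_zero_of_re_pos {q : DQ} (hq : 0 < (fst q).re) : fst q ≠ 0 := fun h => by
  rw [h, Quaternion.re_zero] at hq
  exact hq.false

theorem stLin_isSymmetric {A : Matrix (Fin n) (Fin n) DQ} (hA : A.IsHermitian) :
    (stLin A).IsSymmetric :=
  Matrix.qvecLin_isSymmetric fun i j => by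
    have h := congrArg fst (hA.apply i j)
    rwa [fst_star_s15] at h

theorem infLin_isSymmetric {A : Matrix (Fin n) (Fin n) DQ} (hA : A.IsHermitian) :
    (infLin A).IsSymmetric :=
  Matrix.qvecLin_isSymmetric fun i j => by
    have h := congrArg snd (hA.apply i j)
    rwa [snd_star_s15] at h

theorem fst_sum_s15 {ι : Type*} (s : Finset ι) (f : ι → DQ) :
    fst (∑ i ∈ s, f i) = ∑ i ∈ s, fst (f i) :=
  map_sum (TrivSqZeroExt.fstHom ℝ HQ HQ) f s

theorem snd_sum {ι : Type*} (s : Finset ι) (f : ι → DQ) :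
    snd (∑ i ∈ s, f i) = ∑ i ∈ s, snd (f i) :=
  map_sum (TrivSqZeroExt.sndHom HQ HQ) f s

theorem stVec_mulVec (A : Matrix (Fin n) (Fin n) DQ) (x : Fin n → DQ) :
    stVec (A.mulVec x) = stLin A (stVec x) := by
  ext1 i
  simp [stVec, stLin, Matrix.qvecLin, Matrix.mulVec, dotProduct, fst_sum_s15]

theorem infVec_mulVec (A : Matrix (Fin n) (Fin n) DQ) (x : Fin n → DQ) :
    infVec (A.mulVec x) = stLin A (infVec x) + infLin A (stVec x) := by
  ext1 i
  simp [stVec, infVec, stLin, infLin, Matrix.qvecLin, Matrix.mulVec, dotProduct, snd_sum,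
    Finset.sum_add_distrib]

theorem fst_form (x y : Fin n → DQ) :
    (fst (∑ i, star (x i) * y i)).re = inner ℝ (stVec y) (stVec x) := by
  simp only [QVec.inner_eq_re, stVec, fst_sum_s15, TrivSqZeroExt.fst_mul, fst_star_s15]

theorem snd_form (x y : Fin n → DQ) :
    (snd (∑ i, star (x i) * y i)).re =
      inner ℝ (infVec y) (stVec x) + inner ℝ (stVec y) (infVec x) := by
  simp only [QVec.inner_eq_re, stVec, infVec, snd_sum, DualNumber.snd_mul, fst_star_s15, snd_star_s15,
    Finset.sum_add_distrib, Quaternion.re_add]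

theorem stVec_ne_zero_iff (x : Fin n → DQ) : stVec x ≠ 0 ↔ ∃ i, fst (x i) ≠ 0 := by
  rw [← not_iff_not]
  push Not
  refine ⟨fun h i => congrArg (fun u : QVec n => u i) h, fun h => ?_⟩
  ext1 i
  exact h i

theorem eigen_iff (A : Matrix (Fin n) (Fin n) DQ) (x : Fin n → DQ) (a b : ℝ) :
    A.mulVec x = (fun i => x i * (inl (a : HQ) + inr (b : HQ))) ↔
      stLin A (stVec x) = a • stVec x ∧
        stLin A (infVec x) + infLin A (stVec x) = a • infVec x + b • stVec x := by
  have h₁ : stVec (fun i => x i * (inl (a : HQ) + inr (b : HQ))) = a • stVec x := by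
    ext1 i
    simp [stVec, Quaternion.mul_coe_eq_smul]
  have h₂ : infVec (fun i => x i * (inl (a : HQ) + inr (b : HQ))) =
      a • infVec x + b • stVec x := by
    ext1 i
    simp [stVec, infVec, Quaternion.mul_coe_eq_smul, add_comm]
  rw [← stVec_mulVec, ← infVec_mulVec, ← h₁, ← h₂]
  refine ⟨fun h => by rw [h]; exact ⟨rfl, rfl⟩, fun ⟨hs, hi⟩ => funext fun i => ?_⟩
  exact TrivSqZeroExt.ext (congrArg (fun u : QVec n => u i) hs)
    (congrArg (fun u : QVec n => u i) hi)

/-- The form at an eigenvector, in real terms. -/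
theorem form_eigenvector {A : Matrix (Fin n) (Fin n) DQ} {x : Fin n → DQ} {a b : ℝ}
    (h : A.mulVec x = fun i => x i * (inl (a : HQ) + inr (b : HQ))) :
    (fst (∑ i, star (x i) * A.mulVec x i)).re = a * ‖stVec x‖ ^ 2 ∧
    (snd (∑ i, star (x i) * A.mulVec x i)).re =
      2 * a * inner ℝ (stVec x) (infVec x) + b * ‖stVec x‖ ^ 2 := by
  obtain ⟨h₁, h₂⟩ := (eigen_iff A x a b).1 h
  rw [fst_form, snd_form, stVec_mulVec, infVec_mulVec, h₁, h₂]
  simp only [inner_add_left, real_inner_smul_left, real_inner_self_eq_norm_sq,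
    real_inner_comm (stVec x) (infVec x), true_and]
  ring

theorem exists_min_eigenvalue {A : Matrix (Fin n) (Fin n) DQ} (hA : A.IsHermitian)
    {x : Fin n → DQ} (hx : stVec x ≠ 0) :
    ∃ (a b : ℝ) (y : Fin n → DQ), (∃ i, fst (y i) ≠ 0) ∧
      A.mulVec y = (fun i => y i * (inl (a : HQ) + inr (b : HQ))) ∧
      (∀ w, a * ‖w‖ ^ 2 ≤ inner ℝ (stLin A w) w) ∧
      ∀ w, stLin A w = a • w → b * ‖w‖ ^ 2 ≤ inner ℝ (infLin A w) w := by
  have : Nontrivial (QVec n) := ⟨⟨_, _, hx⟩⟩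
  obtain ⟨a, b, u, v, hu, h₁, h₂, ha, hb⟩ :=
    (stLin_isSymmetric hA).exists_min_dual_eigenvector (infLin_isSymmetric hA)
  have hst : stVec (fun i => (inl (u i) + inr (v i) : DQ)) = u := by
    ext1 i
    simp [stVec]
  have hinf : infVec (fun i => (inl (u i) + inr (v i) : DQ)) = v := by
    ext1 i
    simp [infVec]
  refine ⟨a, b, fun i => inl (u i) + inr (v i), ?_, ?_, ha, hb⟩
  · rwa [← stVec_ne_zero_iff, hst]
  · rw [eigen_iff, hst, hinf]
    exact ⟨h₁, h₂⟩

theorem fst_form_eigenvector_of_eq_zero {A : Matrix (Fin n) (Fin n) DQ} {x : Fin n → DQ} {b : ℝ}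
    (h : A.mulVec x = fun i => x i * (inl ((0 : ℝ) : HQ) + inr (b : HQ))) :
    fst (∑ i, star (x i) * A.mulVec x i) = 0 := by
  simp [h, fst_sum_s15]

end DQ

/-- A dual quaternion Hermitian matrix is positive semidefinite iff all its eigenvalues are
nonnegative dual numbers, and positive definite iff all its eigenvalues are positive and
appreciable dual numbers. -/
theorem hermitian_psd_pd_iff_eigenvalues {n : ℕ}
    (A : Matrix (Fin n) (Fin n) DQ) (hA : A.IsHermitian) :
    ((∀ x : Fin n → DQ, DQ.le 0 (∑ i, star (x i) * A.mulVec x i)) ↔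
      (∀ (lam : DQ) (x : Fin n → DQ), DQ.IsDualNum lam → (∃ i, fst (x i) ≠ 0) →
        A.mulVec x = (fun i => x i * lam) → DQ.le 0 lam)) ∧
    ((∀ x : Fin n → DQ, (∃ i, fst (x i) ≠ 0) →
        DQ.lt 0 (∑ i, star (x i) * A.mulVec x i) ∧
        fst (∑ i, star (x i) * A.mulVec x i) ≠ 0) ↔
      (∀ (lam : DQ) (x : Fin n → DQ), DQ.IsDualNum lam → (∃ i, fst (x i) ≠ 0) →
        A.mulVec x = (fun i => x i * lam) → DQ.lt 0 lam ∧ fst lam ≠ 0)) := by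
  refine ⟨⟨?_, ?_⟩, ?_, ?_⟩
  · rintro h _ x ⟨a, b, rfl⟩ hx hAx
    have hpos : 0 < ‖DQ.stVec x‖ ^ 2 := by
      have := (DQ.stVec_ne_zero_iff x).2 hx
      positivity
    have hform := h x
    rw [DQ.zero_le_iff, (DQ.form_eigenvector hAx).1, (DQ.form_eigenvector hAx).2] at hform
    rw [DQ.zero_le_iff, DQ.re_fst_inl_add_inr, DQ.re_snd_inl_add_inr]
    rcases hform with h₁ | ⟨h₁, h₂⟩
    · exact Or.inl (pos_of_mul_pos_left h₁ hpos.le)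
    · have ha : a = 0 := (mul_eq_zero.1 h₁.symm).resolve_right hpos.ne'
      subst ha
      refine Or.inr ⟨rfl, ?_⟩
      simp only [mul_zero, zero_mul, zero_add] at h₂
      exact nonneg_of_mul_nonneg_left h₂ hpos
  · intro h x
    rw [DQ.zero_le_iff, DQ.fst_form, DQ.snd_form, DQ.stVec_mulVec, DQ.infVec_mulVec]
    by_cases hx : DQ.stVec x = 0
    · simp [hx]
    obtain ⟨a, b, y, hy, hAy, ha, hb⟩ := DQ.exists_min_eigenvalue hA hx
    have hlam := h _ y ⟨a, b, rfl⟩ hy hAy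
    rw [DQ.zero_le_iff, DQ.re_fst_inl_add_inr, DQ.re_snd_inl_add_inr] at hlam
    have hpos : 0 < ‖DQ.stVec x‖ ^ 2 := by positivity
    rcases hlam with ha₀ | ⟨rfl, hb₀⟩
    · exact Or.inl ((mul_pos ha₀ hpos).trans_le (ha _))
    · have hS : ∀ w, 0 ≤ inner ℝ (DQ.stLin A w) w := fun w => by simpa using ha w
      rcases (hS (DQ.stVec x)).lt_or_eq with h₀ | h₀
      · exact Or.inl h₀
      · have hSx := (DQ.stLin_isSymmetric hA).apply_eq_zero_of_inner_eq_zero hS h₀.symm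
        refine Or.inr ⟨h₀, ?_⟩
        rw [inner_add_left, DQ.stLin_isSymmetric hA, hSx, inner_zero_left, inner_zero_right,
          zero_add, add_zero]
        exact (mul_nonneg hb₀ hpos.le).trans (hb _ (by simpa using hSx))
  · rintro h _ x ⟨a, b, rfl⟩ hx hAx
    obtain ⟨hlt, hne⟩ := h x hx
    have ha : 0 < a := by
      have hpos : 0 < ‖DQ.stVec x‖ ^ 2 := by
        have := (DQ.stVec_ne_zero_iff x).2 hx
        positivity
      have ha₀ : a ≠ 0 := by
        rintro rfl
        exact hne (DQ.fst_form_eigenvector_of_eq_zero hAx)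
      rw [DQ.zero_lt_iff, (DQ.form_eigenvector hAx).1] at hlt
      rcases hlt with h₁ | ⟨h₁, -⟩
      · exact pos_of_mul_pos_left h₁ hpos.le
      · exact absurd h₁.symm (mul_ne_zero ha₀ hpos.ne')
    rw [← DQ.re_fst_inl_add_inr a b] at ha
    exact ⟨Or.inl ha, DQ.fst_ne_zero_of_re_pos ha⟩
  · intro h x hx
    have hx' := (DQ.stVec_ne_zero_iff x).2 hx
    obtain ⟨a, b, y, hy, hAy, ha, -⟩ := DQ.exists_min_eigenvalue hA hx'
    have ha₀ : 0 < a := by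
      obtain ⟨hlt, hne⟩ := h _ y ⟨a, b, rfl⟩ hy hAy
      rw [DQ.zero_lt_iff, DQ.re_fst_inl_add_inr] at hlt
      rcases hlt with h₁ | ⟨h₁, -⟩
      · exact h₁
      · simp [← h₁] at hne
    have hform : 0 < (fst (∑ i, star (x i) * A.mulVec x i)).re := by
      rw [DQ.fst_form, DQ.stVec_mulVec]
      exact (mul_pos ha₀ (by positivity)).trans_le (ha _)
    exact ⟨Or.inl hform, DQ.fst_ne_zero_of_re_pos hform⟩
end

section
/- For n ≥ 1, there is no Hermitian dual quaternion matrix L ∈ 𝔻ℚ^{n×n} with L² = ε I_n; in particular, the positive semidefinite dual quaternion Hermitian matrix ε I_n is not a perfect Hermitian matrix. -/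
open TrivSqZeroExt Matrix

/-- The standard part of a Hermitian dual quaternion matrix is Hermitian. -/
theorem fst_apply_of_isHermitian {ι : Type*} {L : Matrix ι ι DQ} (hL : L.IsHermitian)
    (i j : ι) : fst (L j i) = star (fst (L i j)) := by
  have h : star (L i j) = L j i := hL.apply j i
  rw [← h]
  change fst (inl (star (fst (L i j))) + inr (star (snd (L i j))) : DQ) = _
  simp

/-- A Hermitian dual quaternion matrix whose square has vanishing standard part on the diagonal
has vanishing standard part. -/
theorem fst_apply_eq_zero_of_isHermitian {ι : Type*} [Fintype ι] {L : Matrix ι ι DQ}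
    (hL : L.IsHermitian) {i : ι} (h : fst ((L * L) i i) = 0) (j : ι) : fst (L i j) = 0 := by
  have hsum : ∑ k, Quaternion.normSq (fst (L i k)) = 0 := by
    apply Quaternion.coe_injective
    rw [Matrix.mul_apply, fst_sum] at h
    rw [← Quaternion.algebraMap_def, map_sum, map_zero, ← h]
    refine Finset.sum_congr rfl fun k _ => ?_
    rw [fst_mul, fst_apply_of_isHermitian hL i k, Quaternion.self_mul_star,
      Quaternion.algebraMap_def]
  rw [Finset.sum_eq_zero_iff_of_nonneg fun k _ => Quaternion.normSq_nonneg] at hsum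
  exact Quaternion.normSq_eq_zero.mp (hsum j (Finset.mem_univ j))

/-- No Hermitian dual quaternion matrix of positive size squares to `ε I`. -/
theorem mul_self_ne_eps_of_isHermitian {ι : Type*} [Fintype ι] [DecidableEq ι] [Nonempty ι]
    {L : Matrix ι ι DQ} (hL : L.IsHermitian) :
    L * L ≠ Matrix.diagonal (fun _ => (inr (1 : HQ) : DQ)) := by
  intro h
  obtain ⟨i⟩ := ‹Nonempty ι›
  have hii : (L * L) i i = inr 1 := by rw [h, Matrix.diagonal_apply_eq]
  have hz := fst_apply_eq_zero_of_isHermitian hL (i := i) (by rw [hii, fst_inr])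
  have hone : snd ((L * L) i i) = 1 := by rw [hii, snd_inr]
  rw [Matrix.mul_apply, snd_sum] at hone
  refine zero_ne_one (hone ▸ (Finset.sum_eq_zero fun k _ => ?_).symm)
  rw [snd_mul, fst_apply_of_isHermitian hL i k, hz k]
  simp

/-- For `n ≥ 1`, no Hermitian dual quaternion matrix `L` satisfies `L² = ε Iₙ`; in
particular, the positive semidefinite Hermitian matrix `ε Iₙ` is not perfect. -/
theorem eps_identity_not_perfect {n : ℕ} (hn : 1 ≤ n) :
    (∀ L : Matrix (Fin n) (Fin n) DQ, L.IsHermitian →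
      L * L ≠ Matrix.diagonal (fun _ => (inr (1 : HQ) : DQ))) ∧
    ¬ ∃ L : Matrix (Fin n) (Fin n) DQ, L.IsHermitian ∧
      (∀ x : Fin n → DQ, DQ.le 0 (∑ i, star (x i) * L.mulVec x i)) ∧
      L * L = Matrix.diagonal (fun _ => (inr (1 : HQ) : DQ)) := by
  have : Nonempty (Fin n) := ⟨⟨0, hn⟩⟩
  exact ⟨fun _ hL => mul_self_ne_eps_of_isHermitian hL,
    fun ⟨_, hL, _, h⟩ => mul_self_ne_eps_of_isHermitian hL h⟩
end
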